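/- arXiv:1101.1851 — 10 statements merged into one kernel-verified Lean document; each statement's English description precedes it below -/
import Mathlib

section
/- Let x ∈ ℂ with x ≠ 0 and x^N ≠ 1. Then for every n ∈ ℤ one has the inversion relation ω(x|−n) · ω(x^{−1}ζ^{−1}|n) = (−x)^{−n} ζ^{n(n−1)/2}. -/
open Finset

noncomputable def zetaN (N : ℕ) : ℂ := Complex.exp (2 * Real.pi * Complex.I / N)

noncomputable def omegaZ (N : ℕ) (u : ℂ) (n : ℤ) : ℂ :=
  if 0 ≤ n then ∏ j ∈ range n.toNat, (1 - u * zetaN N ^ (j + 1))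
  else (∏ j ∈ range (-n).toNat, (1 - u * zetaN N ^ (-(j : ℤ))))⁻¹

noncomputable def omega2 (N : ℕ) (u v : ℂ) (n : ℤ) : ℂ := v ^ n / omegaZ N u n

noncomputable def omegaStarN (N : ℕ) (u : ℂ) (n : ℕ) : ℂ :=
  ∏ j ∈ range n, (1 - u * zetaN N ^ (-((j : ℤ) + 1)))

noncomputable def gfun (N : ℕ) (x : ℂ) : ℂ :=
  ∏ j ∈ range (N - 1), (1 - x * zetaN N ^ (-((j : ℤ) + 1))) ^ (((j : ℂ) + 1) / (N : ℂ))

noncomputable def hfun (N : ℕ) (x : ℂ) : ℂ := gfun N x / gfun N 1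

noncomputable def brk (N : ℕ) (x : ℂ) : ℂ := (N : ℂ)⁻¹ * ∑ k ∈ range N, x ^ k

noncomputable def ffun (N : ℕ) (x y z : ℂ) : ℂ :=
  ∑ n ∈ range N,
    (∏ j ∈ range (n + 1), (1 - y * zetaN N ^ (j + 1)) / (1 - x * zetaN N ^ (j + 1))) * z ^ (n + 1)

def resN (N : ℕ) (n : ℤ) : ℕ := (n % (N : ℤ)).toNat

lemma zetaN_ne (N : ℕ) : zetaN N ≠ 0 := Complex.exp_ne_zero _

lemma zetaN_pow (N : ℕ) (h : N ≠ 0) : zetaN N ^ N = 1 :=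
  (Complex.isPrimitiveRoot_exp N h).pow_eq_one

lemma factor_ne (N : ℕ) (h : N ≠ 0) (u : ℂ) (hu : u ^ N ≠ 1) (k : ℤ) :
    1 - u * zetaN N ^ k ≠ 0 := by
  intro h0
  apply hu
  have h1 : u * zetaN N ^ k = 1 := (sub_eq_zero.mp h0).symm
  have h2 : (zetaN N ^ k) ^ N = 1 := by
    rw [← zpow_natCast, ← zpow_mul, mul_comm, zpow_mul, zpow_natCast, zetaN_pow N h, one_zpow]
  have h3 := congrArg (· ^ N) h1
  simpa [mul_pow, h2] using h3

lemma omegaZ_nat (N : ℕ) (u : ℂ) (k : ℕ) :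
    omegaZ N u k = ∏ j ∈ range k, (1 - u * zetaN N ^ (j + 1)) := by
  simp [omegaZ]

lemma omegaZ_neg (N : ℕ) (u : ℂ) (k : ℕ) :
    omegaZ N u (-(k : ℤ)) = (∏ j ∈ range k, (1 - u * zetaN N ^ (-(j : ℤ))))⁻¹ := by
  rcases Nat.eq_zero_or_pos k with rfl | hk
  · simp [omegaZ]
  · have : ¬ (0 ≤ -(k : ℤ)) := by omega
    simp only [omegaZ, if_neg this, neg_neg, Int.toNat_natCast]

theorem stmt1 (m N : ℕ) (hm : 1 ≤ m) (hN : N = 2 * m + 1)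
    (x : ℂ) (hx : x ≠ 0) (hxN : x ^ N ≠ 1) (n : ℤ) :
    omegaZ N x (-n) * omegaZ N (x⁻¹ * (zetaN N)⁻¹) n
      = (-x) ^ (-n) * zetaN N ^ (n * (n - 1) / 2) := by
  have hN0 : N ≠ 0 := by omega
  have hz := zetaN_ne N
  have hx' : -x ≠ 0 := neg_ne_zero.mpr hx
  obtain ⟨k, rfl | rfl⟩ := n.eq_nat_or_neg
  · rw [omegaZ_neg, omegaZ_nat]
    induction k with
    | zero => simp
    | succ k ih =>
      rw [prod_range_succ, prod_range_succ, mul_inv, mul_mul_mul_comm, ih]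
      have e : (((k + 1 : ℕ) : ℤ) * (((k + 1 : ℕ) : ℤ) - 1) / 2) = (k : ℤ) * (k - 1) / 2 + k := by
        rw [← Int.add_mul_ediv_right _ _ (by norm_num)]
        congr 1; push_cast; ring
      have hf := factor_ne N hN0 x hxN (-(k : ℤ))
      have key : (1 - x * zetaN N ^ (-(k : ℤ)))⁻¹ * (1 - x⁻¹ * (zetaN N)⁻¹ * zetaN N ^ (k + 1))
          = (-x)⁻¹ * zetaN N ^ (k : ℤ) := by
        rw [inv_mul_eq_iff_eq_mul₀ hf, zpow_neg, zpow_natCast]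
        field_simp
        ring
      rw [key, e, zpow_add₀ hz]
      have e2 : (-x) ^ (-((k + 1 : ℕ) : ℤ)) = (-x) ^ (-(k : ℤ)) * (-x)⁻¹ := by
        rw [← zpow_neg_one, ← zpow_add₀ hx']; congr 1; push_cast; ring
      rw [e2]; ring
  · rw [neg_neg, omegaZ_neg, omegaZ_nat]
    induction k with
    | zero => simp
    | succ k ih =>
      rw [prod_range_succ, prod_range_succ, mul_inv, mul_mul_mul_comm, ih]
      have e : (-((k + 1 : ℕ) : ℤ) * (-((k + 1 : ℕ) : ℤ) - 1) / 2)
          = -(k : ℤ) * (-k - 1) / 2 + ((k + 1 : ℕ) : ℤ) := by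
        rw [← Int.add_mul_ediv_right _ _ (by norm_num)]
        congr 1; push_cast; ring
      have hf : 1 - x * zetaN N ^ (k + 1) ≠ 0 := by
        exact_mod_cast factor_ne N hN0 x hxN ((k + 1 : ℕ) : ℤ)
      have key : (1 - x * zetaN N ^ (k + 1)) * (1 - x⁻¹ * (zetaN N)⁻¹ * zetaN N ^ (-(k : ℤ)))⁻¹
          = (-x) * zetaN N ^ ((k + 1 : ℕ) : ℤ) := by
        have h2 : 1 - x⁻¹ * (zetaN N)⁻¹ * zetaN N ^ (-(k : ℤ))
            = (1 - x * zetaN N ^ (k + 1)) * (-(x * zetaN N ^ (k + 1)))⁻¹ := by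
          rw [zpow_neg, zpow_natCast]
          field_simp
          ring
        rw [h2, mul_inv, inv_inv, mul_inv_cancel_left₀ hf, zpow_natCast]
        ring
      rw [key, e, zpow_add₀ hz, zpow_natCast (-x), zpow_natCast (-x), pow_succ (-x)]
      ring
end

section
/- Let x, z ∈ ℂ with x^N ≠ 1 and z^N = 1 − x^N. Then x · f(x,0|zζ) = (1−z) · f(x,0|z). -/
open Finset

theorem prod_aux (N : ℕ) (hN : 0 < N) (x : ℂ) :
    ∏ j ∈ range N, (1 - x * zetaN N ^ (j + 1)) = 1 - x ^ N := by
  have hp : IsPrimitiveRoot (zetaN N) N := Complex.isPrimitiveRoot_exp N hN.ne'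
  have h1 := hp.pow_sub_pow_eq_prod_sub_mul (1 : ℂ) x hN
  rw [one_pow] at h1
  rw [h1]
  have hN0 : zetaN N ≠ 0 := hp.ne_zero hN.ne'
  refine Finset.prod_bij (fun j _ => zetaN N ^ (j + 1)) ?_ ?_ ?_ ?_
  · intro j _
    rw [Polynomial.mem_nthRootsFinset hN, ← pow_mul, mul_comm, pow_mul, hp.pow_eq_one, one_pow]
  · intro a ha b hb hab
    rw [pow_succ, pow_succ] at hab
    exact hp.pow_inj (mem_range.1 ha) (mem_range.1 hb) (mul_right_cancel₀ hN0 hab)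
  · intro b hb
    rw [Polynomial.mem_nthRootsFinset hN] at hb
    haveI : NeZero N := ⟨hN.ne'⟩
    obtain ⟨i, hi, h⟩ := hp.eq_pow_of_pow_eq_one (ξ := b * (zetaN N)⁻¹)
      (by rw [mul_pow, inv_pow, hp.pow_eq_one, hb]; simp)
    exact ⟨i, mem_range.2 hi, by rw [pow_succ, h]; field_simp⟩
  · intro j _
    ring

theorem stmt2 (m N : ℕ) (hm : 1 ≤ m) (hN : N = 2 * m + 1)
    (x z : ℂ) (hx : x ^ N ≠ 1) (hz : z ^ N = 1 - x ^ N) :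
    x * ffun N x 0 (z * zetaN N) = (1 - z) * ffun N x 0 z := by
  have hN0 : 0 < N := by omega
  have hprod := prod_aux N hN0 x
  have hne : 1 - x ^ N ≠ 0 := sub_ne_zero.2 (Ne.symm hx)
  have hfac : ∀ j ∈ range N, 1 - x * zetaN N ^ (j + 1) ≠ 0 := by
    rw [← Finset.prod_ne_zero_iff, hprod]; exact hne
  set a : ℕ → ℂ := fun n => (∏ j ∈ range n, 1 / (1 - x * zetaN N ^ (j + 1))) * z ^ n with ha
  have haN : a N = 1 := by
    simp only [ha, one_div, Finset.prod_inv_distrib, hprod, hz]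
    exact inv_mul_cancel₀ hne
  have ha0 : a 0 = 1 := by simp [ha]
  have hf1 : ffun N x 0 z = ∑ n ∈ range N, a (n + 1) := by
    simp [ffun, ha]
  have hf2 : ffun N x 0 (z * zetaN N) = ∑ n ∈ range N, a (n + 1) * zetaN N ^ (n + 1) := by
    simp [ffun, ha, mul_pow, mul_assoc]
  have hshift : ∑ n ∈ range N, a (n + 1) = ∑ n ∈ range N, a n := by
    have h1 := Finset.sum_range_succ a N
    have h2 := Finset.sum_range_succ' a N
    rw [h1, ha0, haN] at h2
    exact (add_right_cancel h2).symm
  have hstep : ∑ n ∈ range N, (a (n + 1) - x * (a (n + 1) * zetaN N ^ (n + 1)))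
      = ∑ n ∈ range N, z * a n := by
    refine Finset.sum_congr rfl fun n hn => ?_
    have h := hfac n hn
    have e : a (n + 1) = a n * z / (1 - x * zetaN N ^ (n + 1)) := by
      simp only [ha, Finset.prod_range_succ, pow_succ z]
      ring
    have e2 : a (n + 1) * (1 - x * zetaN N ^ (n + 1)) = a n * z := by
      rw [e]; exact div_mul_cancel₀ _ h
    linear_combination e2
  rw [Finset.sum_sub_distrib, ← Finset.mul_sum, ← Finset.mul_sum, ← hshift, ← hf1, ← hf2] at hstep
  linear_combination -hstep
end

section
/- Let x, z ∈ ℂ with x ≠ 0, x^N ≠ 1 and z^N = 1 − x^N. Then g(x) · g(z/ζ) · f(x,0|z) =_N x^{N−1} g(1), i.e. there is an integer c with g(x) · g(z/ζ) · f(x,0|z) = ζ^c · x^{N−1} g(1). -/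
open Finset

section helpers
open Polynomial

noncomputable def cW (ζ x z : ℂ) (n : ℕ) : ℂ := z ^ n / ∏ j ∈ range n, (1 - x * ζ ^ (j + 1))
noncomputable def cf (N : ℕ) (ζ x z : ℂ) : ℂ := ∑ n ∈ range N, cW ζ x z n
noncomputable def cK (N : ℕ) (ζ x : ℂ) : ℂ := ∏ j ∈ range (N - 1), (1 - x * ζ ^ (j + 1))
noncomputable def cG (N : ℕ) (ζ x : ℂ) : ℂ := ∏ k ∈ range N, (1 - x * (ζ⁻¹) ^ k) ^ k
noncomputable def cR (N : ℕ) (ζ x z : ℂ) : ℂ := ∏ k ∈ range N, cf N ζ x (z * ζ ^ k)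
noncomputable def cU (N : ℕ) (ζ x z : ℂ) : ℂ :=
  ∑ k ∈ range N, x ^ (N - 1 - k) * ∏ i ∈ range k, (1 - z * ζ ^ i)

variable {N : ℕ} {ζ x z : ℂ}

lemma prod_cyc (h : IsPrimitiveRoot ζ N) (hN : 0 < N) (x : ℂ) :
    ∏ k ∈ range N, (1 - x * ζ ^ k) = 1 - x ^ N := by
  have := congrArg (Polynomial.eval 1) (X_pow_sub_C_eq_prod h hN (rfl : x ^ N = x ^ N))
  simp [eval_prod] at this
  rw [this]
  exact prod_congr rfl fun i _ => by ring

lemma prod_cyc' (h : IsPrimitiveRoot ζ N) (hN : 0 < N) (x : ℂ) :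
    ∏ k ∈ range N, (1 - x * ζ ^ (k + 1)) = 1 - x ^ N := by
  have := prod_cyc h hN (x * ζ)
  rw [mul_pow, h.pow_eq_one, mul_one] at this
  rw [← this]
  exact prod_congr rfl fun i _ => by ring

lemma fac_ne (h : IsPrimitiveRoot ζ N) (hx : x ^ N ≠ 1) (k : ℕ) : 1 - x * ζ ^ k ≠ 0 := by
  intro h0
  apply hx
  have h1 : x * ζ ^ k = 1 := (sub_eq_zero.1 h0).symm
  have := congrArg (· ^ N) h1
  simpa [mul_pow, ← pow_mul, mul_comm k N, pow_mul ζ N k, h.pow_eq_one] using this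

lemma cW_zero : cW ζ x z 0 = 1 := by simp [cW]

lemma cW_succ (h : IsPrimitiveRoot ζ N) (hx : x ^ N ≠ 1) (n : ℕ) :
    cW ζ x z (n + 1) * (1 - x * ζ ^ (n + 1)) = z * cW ζ x z n := by
  have h1 := fac_ne h hx (n + 1)
  have h2 : ∏ j ∈ range n, (1 - x * ζ ^ (j + 1)) ≠ 0 :=
    prod_ne_zero_iff.2 fun i _ => fac_ne h hx (i + 1)
  unfold cW
  rw [prod_range_succ]
  field_simp
  ring

lemma cW_N (h : IsPrimitiveRoot ζ N) (hN : 0 < N) (hx : x ^ N ≠ 1) (hz : z ^ N = 1 - x ^ N) :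
    cW ζ x z N = 1 := by
  unfold cW
  rw [prod_cyc' h hN, hz]
  exact div_self (sub_ne_zero.2 hx.symm)

lemma cf_shift (h : IsPrimitiveRoot ζ N) (hN : 0 < N) (hx : x ^ N ≠ 1) (hz : z ^ N = 1 - x ^ N) :
    ∑ n ∈ range N, cW ζ x z (n + 1) = cf N ζ x z := by
  have h1 := sum_range_succ (cW ζ x z) N
  have h2 := sum_range_succ' (cW ζ x z) N
  rw [cW_N h hN hx hz] at h1
  rw [cW_zero] at h2
  unfold cf
  linear_combination h1 - h2

lemma cW_zshift (k n : ℕ) : cW ζ x (z * ζ ^ k) n = (ζ ^ n) ^ k * cW ζ x z n := by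
  unfold cW
  rw [mul_pow, ← pow_mul, ← pow_mul, mul_comm k n]
  ring

lemma curve_shift (h : IsPrimitiveRoot ζ N) (hz : z ^ N = 1 - x ^ N) (k : ℕ) :
    (z * ζ ^ k) ^ N = 1 - x ^ N := by
  rw [mul_pow, ← pow_mul, mul_comm k N, pow_mul, h.pow_eq_one, one_pow, mul_one, hz]

lemma cf_zshift (h : IsPrimitiveRoot ζ N) (hN : 0 < N) (hx : x ^ N ≠ 1)
    (hz : z ^ N = 1 - x ^ N) : x * cf N ζ x (z * ζ) = (1 - z) * cf N ζ x z := by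
  have hz1 := curve_shift h hz 1
  rw [pow_one] at hz1
  have h1 : ∑ n ∈ range N, cW ζ x z (n + 1) * (1 - x * ζ ^ (n + 1)) = z * cf N ζ x z := by
    rw [cf, mul_sum]
    exact sum_congr rfl fun n _ => cW_succ h hx n
  have h2 := cf_shift h hN hx hz1
  have h3 := cf_shift h hN hx hz
  have h4 : ∀ n, cW ζ x (z * ζ) n = ζ ^ n * cW ζ x z n := fun n => by
    have := @cW_zshift ζ x z 1 n
    simpa using this
  simp only [h4] at h2
  rw [← h2, sub_mul, one_mul, ← h1, ← h3, mul_sum, ← sum_sub_distrib]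
  exact sum_congr rfl fun n _ => by ring

lemma cf_zshift_pow (h : IsPrimitiveRoot ζ N) (hN : 0 < N) (hx : x ^ N ≠ 1)
    (hz : z ^ N = 1 - x ^ N) (k : ℕ) :
    x ^ k * cf N ζ x (z * ζ ^ k) = (∏ i ∈ range k, (1 - z * ζ ^ i)) * cf N ζ x z := by
  induction k with
  | zero => simp
  | succ k ih =>
    have := cf_zshift h hN hx (curve_shift h hz k)
    rw [prod_range_succ, pow_succ ζ, ← mul_assoc, pow_succ, mul_assoc, this]
    linear_combination (1 - z * ζ ^ k) * ih

lemma cf_xshift (h : IsPrimitiveRoot ζ N) (hN : 0 < N) (hx : x ^ N ≠ 1)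
    (hz : z ^ N = 1 - x ^ N) : z * cf N ζ (x * ζ) z = (1 - x * ζ) * cf N ζ x z := by
  rw [← cf_shift h hN hx hz, cf, mul_sum, mul_sum]
  refine sum_congr rfl fun n _ => ?_
  unfold cW
  rw [prod_range_succ']
  have h1 := fac_ne h hx 1
  rw [pow_one] at h1
  have h3 : ∀ j, 1 - x * ζ * ζ ^ (j + 1) = 1 - x * ζ ^ (j + 1 + 1) := fun j => by ring
  simp only [h3]
  have h2 : ∏ j ∈ range n, (1 - x * ζ ^ (j + 1 + 1)) ≠ 0 :=
    prod_ne_zero_iff.2 fun i _ => fac_ne h hx (i + 1 + 1)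
  rw [zero_add, pow_one]
  field_simp
  ring

lemma fU (h : IsPrimitiveRoot ζ N) (hN : 0 < N) (hx : x ^ N ≠ 1)
    (hz : z ^ N = 1 - x ^ N) : cU N ζ x z * cf N ζ x z = N * x ^ (N - 1) := by
  have h1 : cU N ζ x z * cf N ζ x z = ∑ k ∈ range N, x ^ (N - 1) * cf N ζ x (z * ζ ^ k) := by
    rw [cU, sum_mul]
    refine sum_congr rfl fun k hk => ?_
    rw [mul_assoc, ← cf_zshift_pow h hN hx hz, ← mul_assoc, ← pow_add]
    congr 2
    have := mem_range.1 hk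
    omega
  rw [h1, ← mul_sum, mul_comm]
  congr 1
  simp only [cf, cW_zshift]
  rw [sum_comm]
  simp only [← sum_mul]
  rw [sum_eq_single 0]
  · simp [cW_zero]
  · intro n hn hn0
    have : (ζ ^ n - 1) * ∑ k ∈ range N, (ζ ^ n) ^ k = 0 := by
      rw [mul_geom_sum, ← pow_mul, mul_comm, pow_mul, h.pow_eq_one, one_pow, sub_self]
    rcases mul_eq_zero.1 this with h0 | h0
    · exact absurd (sub_eq_zero.1 h0) (h.pow_ne_one_of_pos_of_lt hn0 (mem_range.1 hn))
    · rw [h0, zero_mul]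
  · intro h0
    simp at h0
    omega

lemma sum_id_odd {m : ℕ} (hm : N = 2 * m + 1) : ∑ k ∈ range N, k = N * m := by
  have := sum_range_id_mul_two N
  have h2 : N - 1 = 2 * m := by omega
  rw [h2] at this
  nlinarith

lemma cR_xshift {m : ℕ} (hm : N = 2 * m + 1) (h : IsPrimitiveRoot ζ N) (hx : x ^ N ≠ 1)
    (hz : z ^ N = 1 - x ^ N) :
    (1 - x ^ N) * cR N ζ (x * ζ) z = (1 - x * ζ) ^ N * cR N ζ x z := by
  have hN : 0 < N := by omega
  have h1 : ∏ k ∈ range N, (z * ζ ^ k) = 1 - x ^ N := by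
    rw [prod_mul_distrib, prod_const, card_range, prod_pow_eq_pow_sum, sum_id_odd hm, pow_mul,
      h.pow_eq_one, one_pow, mul_one, hz]
  rw [cR, cR, ← h1, ← prod_mul_distrib,
    prod_congr rfl fun k _ => cf_xshift h hN hx (curve_shift h hz k), prod_mul_distrib]
  simp

lemma cG_xshift (h : IsPrimitiveRoot ζ N) (hN : 0 < N) :
    (1 - x * ζ) ^ N * cG N ζ (x * ζ) = (1 - x ^ N) * cG N ζ x := by
  have h0 : ζ ≠ 0 := h.ne_zero hN.ne'
  have h3 : ∀ k, 1 - x * ζ * (ζ⁻¹) ^ (k + 1) = 1 - x * (ζ⁻¹) ^ k := fun k => by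
    rw [pow_succ]; field_simp
  have h2 : cG N ζ (x * ζ) * (1 - x * ζ * (ζ⁻¹) ^ N) ^ N
      = ∏ k ∈ range N, ((1 - x * (ζ⁻¹) ^ k) ^ k * (1 - x * (ζ⁻¹) ^ k)) := by
    rw [cG, ← prod_range_succ (fun k => (1 - x * ζ * (ζ⁻¹) ^ k) ^ k), prod_range_succ']
    rw [pow_zero (1 - _), mul_one]
    refine prod_congr rfl fun k _ => ?_
    rw [h3, pow_succ]
  rw [prod_mul_distrib, prod_cyc h.inv hN, inv_pow, h.pow_eq_one, inv_one, mul_one] at h2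
  unfold cG at *
  linear_combination h2

lemma SG_shift {m : ℕ} (hm : N = 2 * m + 1) (h : IsPrimitiveRoot ζ N) (hx : x ^ N ≠ 1)
    (hz : z ^ N = 1 - x ^ N) :
    cR N ζ (x * ζ) z * cG N ζ (x * ζ) = cR N ζ x z * cG N ζ x := by
  have hN : 0 < N := by omega
  have h1 := cR_xshift hm h hx hz
  have h2 := @cG_xshift N ζ x h hN
  have h3 : 1 - x ^ N ≠ 0 := sub_ne_zero.2 hx.symm
  apply mul_left_cancel₀ h3
  linear_combination cG N ζ (x * ζ) * h1 + cR N ζ x z * h2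

lemma SG_shift_pow {m : ℕ} (hm : N = 2 * m + 1) (h : IsPrimitiveRoot ζ N) (hx : x ^ N ≠ 1)
    (hz : z ^ N = 1 - x ^ N) (k : ℕ) :
    cR N ζ (x * ζ ^ k) z * cG N ζ (x * ζ ^ k) = cR N ζ x z * cG N ζ x := by
  induction k with
  | zero => simp
  | succ k ih =>
    have e : (x * ζ ^ k) ^ N = x ^ N := by
      rw [mul_pow, ← pow_mul, mul_comm k N, pow_mul, h.pow_eq_one, one_pow, mul_one]
    have := SG_shift hm h (x := x * ζ ^ k) (z := z) (by rwa [e]) (by rw [e, hz])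
    rw [pow_succ, ← mul_assoc, this, ih]

lemma cR_eq (h : IsPrimitiveRoot ζ N) (hN : 0 < N) (hx : x ^ N ≠ 1) (hz : z ^ N = 1 - x ^ N) :
    x ^ (∑ k ∈ range N, k) * cR N ζ x z = cG N ζ (z / ζ) * cf N ζ x z ^ N := by
  have h0 : ζ ≠ 0 := h.ne_zero hN.ne'
  rw [cR, ← prod_pow_eq_pow_sum, ← prod_mul_distrib,
    prod_congr rfl fun k _ => cf_zshift_pow h hN hx hz k, prod_mul_distrib, prod_const, card_range]
  congr 1
  have key : ∀ n, ∏ k ∈ range n, ∏ i ∈ range k, (1 - z * ζ ^ i)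
      = ∏ i ∈ range n, (1 - z * ζ ^ i) ^ (n - 1 - i) := by
    intro n
    induction n with
    | zero => simp
    | succ n ih =>
      rw [prod_range_succ, prod_range_succ, ih, ← prod_mul_distrib]
      simp only [Nat.add_sub_cancel, Nat.sub_self, pow_zero, mul_one]
      refine prod_congr rfl fun i hi => ?_
      rw [← pow_succ]
      congr 1
      have := mem_range.1 hi
      omega
  rw [key, ← prod_range_reflect, cG]
  refine prod_congr rfl fun i hi => ?_
  have hi := mem_range.1 hi
  have e1 : N - 1 - (N - 1 - i) = i := by omega
  rw [e1]
  congr 2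
  have e2 : ζ ^ (N - 1 - i) * (ζ ^ i * ζ) = 1 := by
    rw [← pow_succ, ← pow_add, ← h.pow_eq_one]; congr 1; omega
  rw [inv_pow]
  field_simp
  linear_combination z * e2

lemma Kf_eq (h : IsPrimitiveRoot ζ N) (hx : x ^ N ≠ 1) :
    cK N ζ x * cf N ζ x z
      = ∑ n ∈ range N, z ^ n * ∏ j ∈ Ico n (N - 1), (1 - x * ζ ^ (j + 1)) := by
  rw [cf, mul_sum]
  refine sum_congr rfl fun n hn => ?_
  have hn := mem_range.1 hn
  have h2 : ∏ j ∈ range n, (1 - x * ζ ^ (j + 1)) ≠ 0 :=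
    prod_ne_zero_iff.2 fun i _ => fac_ne h hx (i + 1)
  rw [cK, cW, ← prod_range_mul_prod_Ico _ (show n ≤ N - 1 by omega)]
  field_simp

lemma norm_poly (h : IsPrimitiveRoot ζ N) (Q : ℂ[X][X]) :
    ∃ D : ℂ[X], ∀ x z : ℂ, z ^ N = 1 - x ^ N →
      ∏ k ∈ range N, Q.evalEval x (z * ζ ^ k) = D.eval x := by
  set F : ℕ → ℂ[X][X] := fun k => Q.comp (C (C (ζ ^ k)) * X) with hF
  set T : ℂ[X][X] := ∏ k ∈ range N, F k with hT
  have hs : ∀ k, (F k).comp (C (C ζ) * X) = F (k + 1) := by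
    intro k
    simp only [hF, comp_assoc]
    congr 1
    simp only [mul_comp, C_comp, X_comp, pow_succ, C_mul]
    ring
  have hinv : T.comp (C (C ζ) * X) = T := by
    rw [hT, Polynomial.prod_comp]
    simp only [hs]
    by_cases hN : N = 0
    · subst hN; simp
    obtain ⟨n, rfl⟩ := Nat.exists_eq_succ_of_ne_zero hN
    rw [prod_range_succ, prod_range_succ']
    congr 1
    simp only [hF]
    rw [h.pow_eq_one, pow_zero]
  have hc : ∀ n, ¬ N ∣ n → T.coeff n = 0 := by
    intro n hn
    have h1 := congrArg (fun p => coeff p n) hinv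
    simp only [comp_C_mul_X_coeff] at h1
    have h2 : ζ ^ n ≠ 1 := fun h3 => hn (h.dvd_of_pow_eq_one n h3)
    have h3 : T.coeff n * (C (ζ ^ n - 1)) = 0 := by
      rw [C_sub, C_1, mul_sub, C_pow, mul_one, h1, sub_self]
    rcases mul_eq_zero.1 h3 with h4 | h4
    · exact h4
    · exact absurd (sub_eq_zero.1 (C_eq_zero.1 h4)) h2
  refine ⟨∑ n ∈ range (T.natDegree + 1), T.coeff n * (1 - X ^ N) ^ (n / N), fun x z hz => ?_⟩
  have h1 : ∏ k ∈ range N, Q.evalEval x (z * ζ ^ k) = T.evalEval x z := by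
    rw [hT, evalEval_prod]
    refine prod_congr rfl fun k _ => ?_
    simp only [hF, evalEval, eval_comp, eval_mul, eval_C, eval_X, ← C_mul]
    rw [mul_comm]
  rw [h1, evalEval, eval_eq_sum_range (p := T), eval_finsetSum, eval_finsetSum]
  refine sum_congr rfl fun n _ => ?_
  by_cases hn : N ∣ n
  · obtain ⟨q, rfl⟩ := hn
    by_cases hN : N = 0
    · subst hN; simp
    rw [Nat.mul_div_cancel_left _ (Nat.pos_of_ne_zero hN)]
    simp [pow_mul, hz]
  · simp [hc n hn]

lemma infinite_good (hN : 0 < N) : Set.Infinite {x : ℂ | x ≠ 0 ∧ x ^ N ≠ 1} := by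
  have h1 : Set.Finite {x : ℂ | x = 0 ∨ x ^ N = 1} := by
    refine (Set.finite_singleton (0 : ℂ)).union ?_
    refine ((nthRoots N (1 : ℂ)).toFinset.finite_toSet).subset fun x hx => ?_
    have hx' : x ^ N = 1 := hx
    simp [mem_nthRoots hN, hx']
  refine h1.infinite_compl.mono fun x hx => ?_
  simpa [not_or] using hx

lemma exists_z (hN : 0 < N) (x : ℂ) : ∃ z : ℂ, z ^ N = 1 - x ^ N :=
  IsAlgClosed.exists_pow_nat_eq _ hN

lemma cK_one (h : IsPrimitiveRoot ζ N) (hN : 0 < N) : cK N ζ 1 ≠ 0 := by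
  unfold cK
  refine prod_ne_zero_iff.2 fun i hi => ?_
  rw [one_mul, sub_ne_zero]
  have := mem_range.1 hi
  exact (h.pow_ne_one_of_pos_of_lt (by omega) (by omega)).symm

lemma cG_ne (h : IsPrimitiveRoot ζ N) : cG N ζ 1 ≠ 0 := by
  unfold cG
  refine prod_ne_zero_iff.2 fun i hi => ?_
  by_cases h0 : i = 0
  · subst h0; simp
  apply pow_ne_zero
  rw [one_mul, sub_ne_zero]
  exact (h.inv.pow_ne_one_of_pos_of_lt h0 (mem_range.1 hi)).symm

lemma exists_root_mul (h : IsPrimitiveRoot ζ N) (hN : 0 < N) {a : ℂ} (ha : a ^ N = 1) :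
    ∃ k, a * ζ ^ k = 1 := by
  have : NeZero N := ⟨hN.ne'⟩
  obtain ⟨i, hi, e⟩ := h.eq_pow_of_pow_eq_one ha
  refine ⟨N - i, ?_⟩
  rw [← e, ← pow_add, ← h.pow_eq_one]
  congr 1
  omega

/-- a polynomial representing the norm `cR` times `cG` -/
lemma exists_S {m : ℕ} (hm : N = 2 * m + 1) (h : IsPrimitiveRoot ζ N) :
    ∃ S : ℂ[X], (∀ x z : ℂ, x ^ N ≠ 1 → z ^ N = 1 - x ^ N →
      S.eval x = cR N ζ x z * cG N ζ x) ∧ S.eval 1 = cG N ζ 1 ∧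
      ∀ k x, S.eval (x * ζ ^ k) = S.eval x := by
  have hN : 0 < N := by omega
  obtain ⟨D, hD⟩ := norm_poly h (∑ n ∈ range N, X ^ n *
    C (∏ j ∈ Ico n (N - 1), (1 - X * C (ζ ^ (j + 1)))))
  have hD' : ∀ x z : ℂ, x ^ N ≠ 1 → z ^ N = 1 - x ^ N → D.eval x = cK N ζ x ^ N * cR N ζ x z := by
    intro x z hx hz
    rw [← hD x z hz, cR, ← card_range N, ← prod_const, card_range, ← prod_mul_distrib]
    refine prod_congr rfl fun k _ => ?_
    rw [Kf_eq h hx]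
    simp [evalEval, eval_finsetSum, eval_prod]
  have hD1 : D.eval 1 = cK N ζ 1 ^ N := by
    rw [← hD 1 0 (by simp [hN.ne'])]
    simp only [zero_mul]
    rw [prod_const, card_range]
    congr 1
    rw [evalEval_finsetSum, sum_eq_single 0]
    · simp [evalEval, eval_prod, cK]
    · intro n _ hn
      simp [evalEval, hn]
    · intro h0
      simp at h0
      omega
  set Kp : ℂ[X] := (∏ j ∈ range (N - 1), (1 - X * C (ζ ^ (j + 1)))) ^ N with hKp
  have hK : ∀ x, Kp.eval x = cK N ζ x ^ N := fun x => by simp [hKp, cK, eval_prod]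
  set Gp : ℂ[X] := ∏ k ∈ range N, (1 - X * C ((ζ⁻¹) ^ k)) ^ k with hGp
  have hG : ∀ x, Gp.eval x = cG N ζ x := fun x => by
    simp only [hGp, cG, eval_prod, eval_pow, eval_sub, eval_one, eval_mul, eval_X, eval_C]
  have htop : Ideal.span (Set.range fun k : Fin N => Kp.comp (X * C (ζ ^ (k : ℕ)))) = ⊤ := by
    set I := Ideal.span (Set.range fun k : Fin N => Kp.comp (X * C (ζ ^ (k : ℕ)))) with hI
    obtain ⟨g, hg⟩ := (IsPrincipalIdealRing.principal I).principal
    change I = Ideal.span {g} at hg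
    have hdvd : ∀ k : ℕ, k < N → g ∣ Kp.comp (X * C (ζ ^ k)) := by
      intro k hk
      rw [← Ideal.mem_span_singleton, ← hg]
      exact Ideal.subset_span ⟨⟨k, hk⟩, rfl⟩
    by_contra hne
    have hgu : ¬ IsUnit g := fun hu => hne (by rw [hg]; exact Ideal.span_singleton_eq_top.2 hu)
    have hroot : ∀ a, g.eval a = 0 → False := by
      intro a ha
      have hz : ∀ k < N, cK N ζ (a * ζ ^ k) = 0 := by
        intro k hk
        obtain ⟨q, hq⟩ := hdvd k hk
        have := congrArg (eval a) hq
        rw [eval_mul, ha, zero_mul, eval_comp, hK] at this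
        simpa [hN.ne'] using this
      have ha1 : a ^ N = 1 := by
        have := hz 0 hN
        by_contra hc
        rw [pow_zero, mul_one] at this
        exact prod_ne_zero_iff.2 (fun i _ => fac_ne h hc (i + 1)) this
      obtain ⟨k, hk⟩ := exists_root_mul h hN ha1
      have hk' : a * ζ ^ (k % N) = 1 := by
        rw [← hk]; congr 1
        conv_rhs => rw [← Nat.mod_add_div k N, pow_add, pow_mul, h.pow_eq_one, one_pow, mul_one]
      have := hz (k % N) (Nat.mod_lt _ hN)
      rw [hk'] at this
      exact cK_one h hN this
    have hdeg : g.degree = 0 := by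
      by_contra hd
      obtain ⟨a, ha⟩ := IsAlgClosed.exists_root g hd
      exact hroot a ha
    exact hgu (isUnit_iff_degree_eq_zero.2 hdeg)
  have h1 : (1 : ℂ[X]) ∈ Ideal.span (Set.range fun k : Fin N => Kp.comp (X * C (ζ ^ (k : ℕ)))) := by
    rw [htop]; trivial
  obtain ⟨A, hA⟩ := (Ideal.mem_span_range_iff_exists_fun).1 h1
  set S : ℂ[X] := ∑ k : Fin N, A k * (D * Gp).comp (X * C (ζ ^ (k : ℕ))) with hS
  have hSe : ∀ x z : ℂ, x ^ N ≠ 1 → z ^ N = 1 - x ^ N →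
      S.eval x = cR N ζ x z * cG N ζ x := by
    intro x z hx hz
    have e1 := congrArg (eval x) hA
    rw [eval_one, eval_finsetSum] at e1
    rw [hS, eval_finsetSum, ← mul_one (cR N ζ x z * cG N ζ x), ← e1, mul_sum]
    refine sum_congr rfl fun k _ => ?_
    have e : (x * ζ ^ (k : ℕ)) ^ N = x ^ N := by
      rw [mul_pow, ← pow_mul, mul_comm (k : ℕ) N, pow_mul, h.pow_eq_one, one_pow, mul_one]
    simp only [eval_mul, eval_comp, eval_X, eval_C, hK, hG]
    rw [hD' (x * ζ ^ (k : ℕ)) z (by rwa [e]) (by rw [e, hz]),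
      ← SG_shift_pow hm h hx hz k]
    ring
  have hSK : S * Kp = D * Gp := by
    refine eq_of_infinite_eval_eq _ _ ((infinite_good hN).mono fun x hx => ?_)
    obtain ⟨z, hz⟩ := exists_z hN x
    show eval x _ = eval x _
    rw [eval_mul, eval_mul, hSe x z hx.2 hz, hD' x z hx.2 hz, hK, hG]
    ring
  refine ⟨S, hSe, ?_, ?_⟩
  · have := congrArg (eval 1) hSK
    rw [eval_mul, eval_mul, hK, hD1, hG] at this
    have h2 : cK N ζ 1 ^ N ≠ 0 := pow_ne_zero _ (cK_one h hN)
    apply mul_right_cancel₀ h2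
    rw [this]; ring
  · intro k
    have : S.comp (X * C (ζ ^ k)) = S := by
      refine eq_of_infinite_eval_eq _ _ ((infinite_good hN).mono fun x hx => ?_)
      obtain ⟨z, hz⟩ := exists_z hN x
      show eval x _ = eval x _
      have e : (x * ζ ^ (k : ℕ)) ^ N = x ^ N := by
        rw [mul_pow, ← pow_mul, mul_comm (k : ℕ) N, pow_mul, h.pow_eq_one, one_pow, mul_one]
      rw [eval_comp, hSe x z hx.2 hz]
      simp only [eval_mul, eval_X, eval_C]
      rw [hSe (x * ζ ^ k) z (by rw [e]; exact hx.2) (by rw [e, hz]), SG_shift_pow hm h hx.2 hz k]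
    intro x
    have := congrArg (eval x) this
    simpa [eval_comp] using this

lemma exists_V (h : IsPrimitiveRoot ζ N) :
    ∃ V : ℂ[X], ∀ x z : ℂ, z ^ N = 1 - x ^ N →
      ∏ k ∈ range N, cU N ζ x (z * ζ ^ k) = V.eval x := by
  obtain ⟨V, hV⟩ := norm_poly h (∑ k ∈ range N, C (X ^ (N - 1 - k)) *
    ∏ i ∈ range k, (1 - X * C (C (ζ ^ i))))
  refine ⟨V, fun x z hz => ?_⟩
  rw [← hV x z hz]
  refine prod_congr rfl fun k _ => ?_
  simp [cU, evalEval, eval_finsetSum, eval_prod]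

lemma UR (h : IsPrimitiveRoot ζ N) (hN : 0 < N) (hx : x ^ N ≠ 1) (hz : z ^ N = 1 - x ^ N) :
    (∏ k ∈ range N, cU N ζ x (z * ζ ^ k)) * cR N ζ x z = (N * x ^ (N - 1)) ^ N := by
  rw [cR, ← prod_mul_distrib, prod_congr rfl fun k _ => fU h hN hx (curve_shift h hz k)]
  simp

/-- the norm is a monomial -/
lemma S_monomial {m : ℕ} (hm : N = 2 * m + 1) (h : IsPrimitiveRoot ζ N) :
    ∃ d : ℕ, ∀ x z : ℂ, x ^ N ≠ 1 → z ^ N = 1 - x ^ N →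
      cR N ζ x z * cG N ζ x = cG N ζ 1 * x ^ d := by
  have hN : 0 < N := by omega
  obtain ⟨S, hS, hS1, hSinv⟩ := exists_S hm h
  obtain ⟨V, hV⟩ := exists_V h
  set Gp : ℂ[X] := ∏ k ∈ range N, (1 - X * C ((ζ⁻¹) ^ k)) ^ k with hGp
  have hG : ∀ x, Gp.eval x = cG N ζ x := fun x => by
    simp only [hGp, cG, eval_prod, eval_pow, eval_sub, eval_one, eval_mul, eval_X, eval_C]
  have hN0 : (N : ℂ) ≠ 0 := by exact_mod_cast hN.ne'
  have hSV : S * V = C ((N : ℂ) ^ N) * (Gp * X ^ ((N - 1) * N)) := by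
    refine eq_of_infinite_eval_eq _ _ ((infinite_good hN).mono fun x hx => ?_)
    obtain ⟨z, hz⟩ := exists_z hN x
    show eval x _ = eval x _
    simp only [eval_mul, eval_pow, eval_C, eval_X, hG]
    rw [hS x z hx.2 hz, ← hV x z hz]
    have := UR h hN hx.2 hz
    rw [mul_pow, ← pow_mul] at this
    linear_combination cG N ζ x * this
  have hu : IsUnit (C ((N : ℂ) ^ N)) := isUnit_C.2 (pow_ne_zero _ hN0).isUnit
  have hdvd : S ∣ Gp * X ^ ((N - 1) * N) := by
    rw [← hu.dvd_mul_left, ← hSV]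
    exact dvd_mul_right _ _
  have hcop : IsCoprime S Gp := by
    rw [isCoprime_iff_aeval_ne_zero_of_isAlgClosed ℂ ℂ]
    intro a
    by_contra hc
    push Not at hc
    simp only [coe_aeval_eq_eval] at hc
    have ha : a ^ N = 1 := by
      by_contra hne
      refine absurd hc.2 ?_
      rw [hG, cG]
      exact prod_ne_zero_iff.2 fun i _ => pow_ne_zero _ (fac_ne h.inv hne i)
    obtain ⟨k, hk⟩ := exists_root_mul h hN ha
    have := hSinv k a
    rw [hk, hc.1, hS1] at this
    exact cG_ne h this
  have hdvd2 := hcop.dvd_of_dvd_mul_left hdvd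
  obtain ⟨d, -, hd⟩ := (dvd_prime_pow prime_X _).1 hdvd2
  obtain ⟨u, hu⟩ := hd.symm
  obtain ⟨c, hc, hcu⟩ := Polynomial.isUnit_iff.1 u.isUnit
  rw [← hcu] at hu
  have hc1 : c = cG N ζ 1 := by
    rw [← hS1, ← hu]; simp
  refine ⟨d, fun x z hx hz => ?_⟩
  rw [← hS x z hx hz, ← hu, ← hc1, eval_mul, eval_pow, eval_X, eval_C, mul_comm]

lemma exp_le {a b : ℕ} {A : ℝ} (hA : ∀ t : ℝ, 2 ≤ t → t ^ a ≤ A * t ^ b) : a ≤ b := by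
  by_contra hlt
  push Not at hlt
  obtain ⟨c, rfl⟩ := Nat.exists_eq_add_of_lt hlt
  set t : ℝ := max 2 (A + 1) with ht
  have h2 : (2 : ℝ) ≤ t := le_max_left _ _
  have h3 : A + 1 ≤ t := le_max_right _ _
  have h1 := hA t h2
  have hp : 0 < t ^ b := by positivity
  have e : t ^ (b + c + 1) = (t ^ c * t) * t ^ b := by ring
  rw [e] at h1
  have h4 := le_of_mul_le_mul_right h1 hp
  have h5 : 1 ≤ t ^ c := one_le_pow₀ (by linarith)
  nlinarith

lemma norm_fac_le {η : ℂ} (hη : ‖η‖ = 1) (x : ℂ) : ‖1 - x * η‖ ≤ 1 + ‖x‖ := by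
  have := norm_sub_le 1 (x * η)
  simpa [hη] using this

lemma le_norm_fac {η : ℂ} (hη : ‖η‖ = 1) (x : ℂ) : ‖x‖ - 1 ≤ ‖1 - x * η‖ := by
  have := norm_sub_norm_le (x * η) 1
  rw [norm_sub_rev] at this
  simpa [hη] using this

lemma big_ne (hN : 0 < N) (hx : 2 ≤ ‖x‖) : x ^ N ≠ 1 := by
  intro h0
  have := congrArg norm h0
  rw [norm_pow, norm_one] at this
  have h1 : 1 < ‖x‖ ^ N := one_lt_pow₀ (by linarith) hN.ne'
  linarith

lemma z_bound (hN : 0 < N) (hx : 2 ≤ ‖x‖) (hz : z ^ N = 1 - x ^ N) : ‖z‖ ≤ 2 * ‖x‖ := by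
  rw [← pow_le_pow_iff_left₀ (norm_nonneg _) (by positivity) hN.ne', ← norm_pow, hz, mul_pow]
  have h1 : 1 ≤ ‖x‖ ^ N := one_le_pow₀ (by linarith)
  have h2 : (2 : ℝ) ≤ 2 ^ N := le_self_pow₀ (by norm_num) hN.ne'
  have h3 := norm_sub_le 1 (x ^ N)
  rw [norm_one, norm_pow] at h3
  nlinarith

lemma cf_bound (h : IsPrimitiveRoot ζ N) (hN : 0 < N) (hx : 2 ≤ ‖x‖) (hz : z ^ N = 1 - x ^ N) :
    ‖cf N ζ x z‖ ≤ N * 4 ^ N := by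
  have hζ : ‖ζ‖ = 1 := h.norm'_eq_one hN.ne'
  have hzb := z_bound hN hx hz
  unfold cf
  refine (norm_sum_le _ _).trans ?_
  have : ∀ n ∈ range N, ‖cW ζ x z n‖ ≤ 4 ^ N := by
    intro n hn
    have hn := (mem_range.1 hn).le
    rw [cW, norm_div, norm_pow, norm_prod]
    have h1 : (‖x‖ / 2) ^ n ≤ ∏ j ∈ range n, ‖1 - x * ζ ^ (j + 1)‖ := by
      have := prod_le_prod (s := range n) (f := fun _ => ‖x‖ / 2)
        (g := fun j => ‖1 - x * ζ ^ (j + 1)‖) (fun _ _ => by positivity) (fun j _ => by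
          have := le_norm_fac (η := ζ ^ (j + 1)) (by rw [norm_pow, hζ, one_pow]) x
          linarith)
      simpa [div_pow] using this
    have h0 : 0 < (‖x‖ / 2) ^ n := by positivity
    rw [div_le_iff₀ (h0.trans_le h1)]
    calc ‖z‖ ^ n ≤ (2 * ‖x‖) ^ n := by gcongr
      _ = 4 ^ n * (‖x‖ / 2) ^ n := by rw [← mul_pow]; congr 1; ring
      _ ≤ 4 ^ N * ∏ j ∈ range n, ‖1 - x * ζ ^ (j + 1)‖ := by
        gcongr
        norm_num
  refine (sum_le_sum this).trans ?_
  simp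

lemma cR_bound (h : IsPrimitiveRoot ζ N) (hN : 0 < N) (hx : 2 ≤ ‖x‖) (hz : z ^ N = 1 - x ^ N) :
    ‖cR N ζ x z‖ ≤ (N * 4 ^ N) ^ N := by
  rw [cR, norm_prod]
  have := prod_le_prod (s := range N) (f := fun k => ‖cf N ζ x (z * ζ ^ k)‖)
    (g := fun _ => (N * 4 ^ N : ℝ)) (fun _ _ => norm_nonneg _)
    (fun k _ => cf_bound h hN hx (curve_shift h hz k))
  simpa using this

lemma cU_bound (h : IsPrimitiveRoot ζ N) (hN : 0 < N) (hx : 2 ≤ ‖x‖) (hz : z ^ N = 1 - x ^ N) :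
    ‖cU N ζ x z‖ ≤ N * (3 ^ N * ‖x‖ ^ (N - 1)) := by
  have hζ : ‖ζ‖ = 1 := h.norm'_eq_one hN.ne'
  have hzb := z_bound hN hx hz
  unfold cU
  refine (norm_sum_le _ _).trans ?_
  have : ∀ k ∈ range N, ‖x ^ (N - 1 - k) * ∏ i ∈ range k, (1 - z * ζ ^ i)‖
      ≤ 3 ^ N * ‖x‖ ^ (N - 1) := by
    intro k hk
    have hk := mem_range.1 hk
    rw [norm_mul, norm_pow, norm_prod]
    have h1 : ∏ i ∈ range k, ‖1 - z * ζ ^ i‖ ≤ (3 * ‖x‖) ^ k := by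
      have := prod_le_prod (s := range k) (f := fun j => ‖1 - z * ζ ^ j‖)
        (g := fun _ => 3 * ‖x‖) (fun _ _ => norm_nonneg _) (fun j _ => by
          have := norm_fac_le (η := ζ ^ j) (by rw [norm_pow, hζ, one_pow]) z
          linarith)
      simpa using this
    calc _ ≤ ‖x‖ ^ (N - 1 - k) * (3 * ‖x‖) ^ k := by gcongr
      _ = 3 ^ k * ‖x‖ ^ (N - 1) := by
        have e : N - 1 = (N - 1 - k) + k := by omega
        conv_rhs => rw [e, pow_add]
        rw [mul_pow]; ring
      _ ≤ _ := by
        gcongr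
        norm_num
  refine (sum_le_sum this).trans ?_
  simp

lemma cR_lower (h : IsPrimitiveRoot ζ N) (hN : 0 < N) (hx : 2 ≤ ‖x‖) (hz : z ^ N = 1 - x ^ N) :
    1 ≤ (3 ^ N) ^ N * ‖cR N ζ x z‖ := by
  have h1 := congrArg norm (UR h hN (big_ne hN hx) hz)
  have h2 : ‖∏ k ∈ range N, cU N ζ x (z * ζ ^ k)‖ ≤ (N * (3 ^ N * ‖x‖ ^ (N - 1))) ^ N := by
    rw [norm_prod]
    have := prod_le_prod (s := range N) (f := fun k => ‖cU N ζ x (z * ζ ^ k)‖)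
      (g := fun _ => (N * (3 ^ N * ‖x‖ ^ (N - 1)) : ℝ)) (fun _ _ => norm_nonneg _)
      (fun k _ => cU_bound h hN hx (curve_shift h hz k))
    simpa using this
  rw [norm_mul, norm_pow, norm_mul, norm_pow, Complex.norm_natCast] at h1
  have h3 := mul_le_mul_of_nonneg_right h2 (norm_nonneg (cR N ζ x z))
  rw [h1] at h3
  have hp : 0 < ((N : ℝ) * ‖x‖ ^ (N - 1)) ^ N := by
    have : (0 : ℝ) < N := by exact_mod_cast hN
    positivity
  refine le_of_mul_le_mul_left ?_ hp
  rw [mul_one]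
  refine h3.trans (le_of_eq ?_)
  simp only [mul_pow]
  ring

lemma cG_le (h : IsPrimitiveRoot ζ N) (hN : 0 < N) (hx : 2 ≤ ‖x‖) :
    ‖cG N ζ x‖ ≤ (2 * ‖x‖) ^ (∑ k ∈ range N, k) := by
  have hζ : ‖ζ⁻¹‖ = 1 := h.inv.norm'_eq_one hN.ne'
  rw [cG, norm_prod, ← prod_pow_eq_pow_sum]
  refine prod_le_prod (fun _ _ => norm_nonneg _) fun k _ => ?_
  rw [norm_pow]
  have := norm_fac_le (η := (ζ⁻¹) ^ k) (by rw [norm_pow, hζ, one_pow]) x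
  gcongr
  linarith

lemma le_cG (h : IsPrimitiveRoot ζ N) (hN : 0 < N) (hx : 2 ≤ ‖x‖) :
    (‖x‖ / 2) ^ (∑ k ∈ range N, k) ≤ ‖cG N ζ x‖ := by
  have hζ : ‖ζ⁻¹‖ = 1 := h.inv.norm'_eq_one hN.ne'
  rw [cG, norm_prod, ← prod_pow_eq_pow_sum]
  refine prod_le_prod (fun _ _ => by positivity) fun k _ => ?_
  rw [norm_pow]
  have := le_norm_fac (η := (ζ⁻¹) ^ k) (by rw [norm_pow, hζ, one_pow]) x
  gcongr
  linarith

lemma SG_eq {m : ℕ} (hm : N = 2 * m + 1) (h : IsPrimitiveRoot ζ N) (hx : x ^ N ≠ 1)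
    (hz : z ^ N = 1 - x ^ N) :
    cR N ζ x z * cG N ζ x = cG N ζ 1 * x ^ (∑ k ∈ range N, k) := by
  have hN : 0 < N := by omega
  obtain ⟨d, hd⟩ := S_monomial hm h
  have hg : 0 < ‖cG N ζ 1‖ := norm_pos_iff.2 (cG_ne h)
  set M := ∑ k ∈ range N, k with hM
  have key : ∀ t : ℝ, 2 ≤ t → ∃ y w : ℂ, ‖y‖ = t ∧ 2 ≤ ‖y‖ ∧ w ^ N = 1 - y ^ N ∧
      ‖cR N ζ y w‖ * ‖cG N ζ y‖ = ‖cG N ζ 1‖ * t ^ d := by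
    intro t ht
    obtain ⟨w, hw⟩ := exists_z hN (t : ℂ)
    have e : ‖(t : ℂ)‖ = t := by
      rw [Complex.norm_real, Real.norm_eq_abs, abs_of_nonneg (by linarith)]
    have e2 : 2 ≤ ‖(t : ℂ)‖ := by rwa [e]
    refine ⟨t, w, e, e2, hw, ?_⟩
    have := congrArg norm (hd t w (big_ne hN e2) hw)
    rwa [norm_mul, norm_mul, norm_pow, e] at this
  have h1 : d ≤ M := by
    refine exp_le (A := (N * 4 ^ N) ^ N * 2 ^ M / ‖cG N ζ 1‖) fun t ht => ?_
    obtain ⟨y, w, hy, hy2, hw, e⟩ := key t ht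
    have b1 := cR_bound h hN hy2 hw
    have b2 := cG_le h hN hy2
    rw [hy, ← hM, mul_pow] at b2
    rw [div_mul_eq_mul_div, le_div_iff₀ hg, mul_comm, ← e, mul_assoc]
    exact mul_le_mul b1 b2 (norm_nonneg _) (by positivity)
  have h2 : M ≤ d := by
    refine exp_le (A := 2 ^ M * (3 ^ N) ^ N * ‖cG N ζ 1‖) fun t ht => ?_
    obtain ⟨y, w, hy, hy2, hw, e⟩ := key t ht
    have b1 := cR_lower h hN hy2 hw
    have b2 := le_cG h hN hy2
    rw [hy, ← hM, div_pow, div_le_iff₀ (by positivity)] at b2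
    rw [mul_assoc, ← e]
    calc t ^ M ≤ ‖cG N ζ y‖ * 2 ^ M := b2
      _ = ‖cG N ζ y‖ * 2 ^ M * 1 := (mul_one _).symm
      _ ≤ ‖cG N ζ y‖ * 2 ^ M * ((3 ^ N) ^ N * ‖cR N ζ y w‖) := by gcongr
      _ = _ := by ring
  rw [hd x z hx hz, le_antisymm h1 h2]

lemma gfun_pow (hN : 0 < N) (x : ℂ) : gfun N x ^ N = cG N (zetaN N) x := by
  have hN0 : (N : ℂ) ≠ 0 := by exact_mod_cast hN.ne'
  obtain ⟨n, rfl⟩ := Nat.exists_eq_succ_of_ne_zero hN.ne'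
  rw [gfun, cG, prod_range_succ', ← prod_pow]
  simp only [pow_zero, mul_one, Nat.succ_sub_one]
  refine prod_congr rfl fun j _ => ?_
  rw [← Complex.cpow_nat_mul, mul_div_cancel₀ _ hN0]
  have e : (j : ℂ) + 1 = ((j + 1 : ℕ) : ℂ) := by push_cast; rfl
  rw [e, Complex.cpow_natCast]
  congr 3
  rw [inv_pow, zpow_neg]
  norm_cast

lemma ffun_eq (h : IsPrimitiveRoot (zetaN N) N) (hN : 0 < N) (hx : x ^ N ≠ 1)
    (hz : z ^ N = 1 - x ^ N) : ffun N x 0 z = cf N (zetaN N) x z := by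
  rw [← cf_shift h hN hx hz, ffun]
  refine sum_congr rfl fun n _ => ?_
  simp only [zero_mul, sub_zero]
  rw [cW, prod_div_distrib]
  simp only [prod_const_one]
  ring

end helpers

theorem stmt3 (m N : ℕ) (hm : 1 ≤ m) (hN : N = 2 * m + 1)
    (x z : ℂ) (hx0 : x ≠ 0) (hx : x ^ N ≠ 1) (hz : z ^ N = 1 - x ^ N) :
    ∃ c : ℤ, gfun N x * gfun N (z / zetaN N) * ffun N x 0 z
      = zetaN N ^ c * (x ^ (N - 1) * gfun N 1) := by
  
  have hN0 : 0 < N := by omega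
  have h : IsPrimitiveRoot (zetaN N) N := Complex.isPrimitiveRoot_exp N hN0.ne'
  have : NeZero N := ⟨hN0.ne'⟩
  set B := x ^ (N - 1) * gfun N 1 with hB
  set A := gfun N x * gfun N (z / zetaN N) * ffun N x 0 z with hA
  have hg : gfun N 1 ≠ 0 := by
    intro h0
    have := gfun_pow hN0 1
    rw [h0, zero_pow hN0.ne'] at this
    exact cG_ne h this.symm
  have hB0 : B ≠ 0 := mul_ne_zero (pow_ne_zero _ hx0) hg
  have hAB : A ^ N = B ^ N := by
    rw [hA, hB, mul_pow, mul_pow, mul_pow, gfun_pow hN0, gfun_pow hN0, gfun_pow hN0,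
      ffun_eq h hN0 hx hz]
    have e1 := cR_eq h hN0 hx hz
    have e2 := SG_eq hN h hx hz
    have e3 : (x ^ (N - 1)) ^ N
        = x ^ (∑ k ∈ range N, k) * x ^ (∑ k ∈ range N, k) := by
      rw [← pow_mul, ← pow_add, ← mul_two, sum_range_id_mul_two, mul_comm]
    rw [e3]
    linear_combination (-cG N (zetaN N) x) * e1 + x ^ (∑ k ∈ range N, k) * e2
  have hq : (A / B) ^ N = 1 := by rw [div_pow, hAB, div_self (pow_ne_zero _ hB0)]
  obtain ⟨i, -, e⟩ := h.eq_pow_of_pow_eq_one hq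
  refine ⟨i, ?_⟩
  rw [zpow_natCast, e, div_mul_cancel₀ _ hB0]
end

section
/- Let x, y, z ∈ ℂ with x^N ≠ 1, y^N ≠ 1, z^N = (1−x^N)/(1−y^N), and x − yzζ ≠ 0. Then f(x, y | zζ) = ((1−z)/(x − yzζ)) · f(x, y | z). -/
open Finset

theorem zetaN_prod (N : ℕ) (hN : 0 < N) (u : ℂ) :
    ∏ j ∈ range N, (1 - u * zetaN N ^ (j + 1)) = 1 - u ^ N := by
  have hp : IsPrimitiveRoot (zetaN N) N := Complex.isPrimitiveRoot_exp N hN.ne'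
  have h := hp.pow_sub_pow_eq_prod_sub_mul 1 u hN
  rw [one_pow] at h
  rw [h]
  refine Finset.prod_bij (fun j _ => zetaN N ^ (j + 1)) ?_ ?_ ?_ ?_
  · intro j _
    rw [Polynomial.mem_nthRootsFinset hN, ← pow_mul, mul_comm, pow_mul, hp.pow_eq_one, one_pow]
  · intro i hi j hj hij
    have h0 : zetaN N ≠ 0 := hp.ne_zero hN.ne'
    simp only [pow_succ] at hij
    exact hp.pow_inj (mem_range.1 hi) (mem_range.1 hj) (mul_right_cancel₀ h0 hij)
  · intro b hb
    have h0 : zetaN N ≠ 0 := hp.ne_zero hN.ne'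
    rw [Polynomial.mem_nthRootsFinset hN] at hb
    have hb' : (b * (zetaN N)⁻¹) ^ N = 1 := by
      rw [mul_pow, inv_pow, hp.pow_eq_one, hb]; simp
    haveI : NeZero N := ⟨hN.ne'⟩
    obtain ⟨i, hi, h⟩ := hp.eq_pow_of_pow_eq_one hb'
    refine ⟨i, mem_range.2 hi, ?_⟩
    rw [pow_succ, h, mul_assoc, inv_mul_cancel₀ h0, mul_one]
  · intro j _
    ring

theorem stmt6 (m N : ℕ) (hm : 1 ≤ m) (hN : N = 2 * m + 1)
    (x y z : ℂ) (hx : x ^ N ≠ 1) (hy : y ^ N ≠ 1)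
    (hz : z ^ N = (1 - x ^ N) / (1 - y ^ N)) (hd : x - y * z * zetaN N ≠ 0) :
    ffun N x y (z * zetaN N) = ((1 - z) / (x - y * z * zetaN N)) * ffun N x y z := by
  have hN0 : 0 < N := by omega
  have hp : IsPrimitiveRoot (zetaN N) N := Complex.isPrimitiveRoot_exp N hN0.ne'
  have hx1 : 1 - x ^ N ≠ 0 := sub_ne_zero.2 (Ne.symm hx)
  have hy1 : 1 - y ^ N ≠ 0 := sub_ne_zero.2 (Ne.symm hy)
  have hPx := zetaN_prod N hN0 x
  have hPy := zetaN_prod N hN0 y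
  have hfac : ∀ j ∈ range N, 1 - x * zetaN N ^ (j + 1) ≠ 0 := by
    apply Finset.prod_ne_zero_iff.1
    rw [hPx]; exact hx1
  set b : ℕ → ℂ := fun n =>
    (∏ j ∈ range n, (1 - y * zetaN N ^ (j + 1)) / (1 - x * zetaN N ^ (j + 1))) * z ^ n with hb
  have hb0 : b 0 = 1 := by simp [hb]
  have hbN : b N = 1 := by
    simp only [hb]
    rw [Finset.prod_div_distrib, hPx, hPy, hz]
    field_simp
  have hf1 : ffun N x y z = ∑ n ∈ range N, b (n + 1) := rfl
  have hf2 : ffun N x y (z * zetaN N) = ∑ n ∈ range N, b (n + 1) * zetaN N ^ (n + 1) := by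
    unfold ffun
    refine Finset.sum_congr rfl fun n _ => ?_
    simp only [hb]
    rw [mul_pow, mul_assoc]
  have hs1 : ∑ n ∈ range N, b n = ∑ n ∈ range N, b (n + 1) := by
    have h1 := Finset.sum_range_succ b N
    rw [Finset.sum_range_succ', hb0, hbN] at h1
    exact (add_right_cancel h1).symm
  have hs2 : ∑ n ∈ range N, b n * zetaN N ^ n
      = ∑ n ∈ range N, b (n + 1) * zetaN N ^ (n + 1) := by
    have h1 := Finset.sum_range_succ (fun n => b n * zetaN N ^ n) N
    rw [Finset.sum_range_succ', hb0, hbN, hp.pow_eq_one, pow_zero] at h1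
    exact (add_right_cancel h1).symm
  have hrec : ∀ n ∈ range N, b (n + 1) - x * (b (n + 1) * zetaN N ^ (n + 1))
      = z * b n - z * y * zetaN N * (b n * zetaN N ^ n) := by
    intro n hn
    have h := hfac n hn
    have h2 : b (n + 1) * (1 - x * zetaN N ^ (n + 1))
        = z * b n * (1 - y * zetaN N ^ (n + 1)) := by
      simp only [hb]
      rw [Finset.prod_range_succ, pow_succ z]
      generalize (∏ j ∈ range n, (1 - y * zetaN N ^ (j + 1)) / (1 - x * zetaN N ^ (j + 1))) = P
      generalize 1 - x * zetaN N ^ (n + 1) = d at *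
      field_simp
    linear_combination h2
  have hsum := Finset.sum_congr rfl hrec
  rw [Finset.sum_sub_distrib, Finset.sum_sub_distrib, ← Finset.mul_sum, ← Finset.mul_sum,
    ← Finset.mul_sum, hs1, hs2, ← hf1, ← hf2] at hsum
  rw [div_mul_eq_mul_div, eq_div_iff hd]
  linear_combination -hsum
end

section
/- (Fourier transform of the matrix dilogarithm.) Let u, v ∈ ℂ with u^N + v^N = 1, u ≠ 0 and u^N ≠ 1. Then for all i, j, k, l ∈ ℤ/N one has: N^{−2} Σ_{α,β,γ,δ ∈ ℤ/N} ζ^{kα + lβ − iγ − jδ} · L_N(u,v)^{γ,δ}_{α,β} =_N N^{−1} g(v/ζ)^{−1} u^{N−1} ζ^{(k−i)(j−l) + (m+1)(j²−l²)} / ω(v/ζ, u | l−i), i.e. the two sides agree up to multiplication by an N-th root of unity (with the same root of unity for all i,j,k,l). -/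
open Finset

noncomputable def LN (m : ℕ) (u v : ℂ) (i j k l : ZMod (2 * m + 1)) : ℂ :=
  hfun (2 * m + 1) u * zetaN (2 * m + 1) ^ (k.val * j.val + (m + 1) * k.val ^ 2) *
    omega2 (2 * m + 1) u v (((i - k).val : ℤ)) * (if i + j = l then 1 else 0)


namespace FT

noncomputable def om (z u : ℂ) (n : ℕ) : ℂ := ∏ j ∈ range n, (1 - u * z ^ (j + 1))
noncomputable def F (N : ℕ) (z u v : ℂ) : ℂ := ∑ n ∈ range N, v ^ n / om z u n
noncomputable def G (N : ℕ) (w x : ℂ) : ℂ := ∏ j ∈ range N, (1 - x * w ^ j) ^ j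

lemma prod_lin {N : ℕ} (hN : 0 < N) {z : ℂ} (hz : IsPrimitiveRoot z N) (u : ℂ) :
    ∏ j ∈ range N, (1 - u * z ^ j) = 1 - u ^ N := by
  have h := congrArg (Polynomial.eval 1) (X_pow_sub_C_eq_prod hz hN (rfl : u ^ N = u ^ N))
  simp only [Polynomial.eval_sub, Polynomial.eval_pow, Polynomial.eval_X, Polynomial.eval_C,
    Polynomial.eval_prod, one_pow] at h
  rw [h]
  exact prod_congr rfl fun j _ => by ring

lemma om_N {N : ℕ} (hN : 0 < N) {z : ℂ} (hz : IsPrimitiveRoot z N) (u : ℂ) :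
    om z u N = 1 - u ^ N := by
  rw [← prod_lin hN hz u, om]
  have h1 := prod_range_succ (fun j => 1 - u * z ^ j) N
  have h2 := prod_range_succ' (fun j => 1 - u * z ^ j) N
  obtain ⟨M, rfl⟩ : ∃ M, N = M + 1 := ⟨N - 1, by omega⟩
  rw [prod_range_succ, prod_range_succ', hz.pow_eq_one, pow_zero]

lemma lin_ne {N : ℕ} (_hN : 0 < N) {z : ℂ} (hz : z ^ N = 1) {u : ℂ} (hu : u ^ N ≠ 1)
    (j : ℕ) : 1 - u * z ^ j ≠ 0 := by
  intro h
  apply hu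
  have h1 : u * z ^ j = 1 := by linear_combination -h
  have h2 : (u * z ^ j) ^ N = 1 := by rw [h1, one_pow]
  rwa [mul_pow, ← pow_mul, mul_comm j N, pow_mul, hz, one_pow, mul_one] at h2

lemma om_ne {N : ℕ} (hN : 0 < N) {z : ℂ} (hz : z ^ N = 1) {u : ℂ} (hu : u ^ N ≠ 1)
    (j : ℕ) : om z u j ≠ 0 := prod_ne_zero_iff.2 fun _ _ => lin_ne hN hz hu _

lemma om_succ (z u : ℂ) (n : ℕ) : om z u (n+1) = om z u n * (1 - u * z ^ (n+1)) :=
  prod_range_succ _ _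

lemma sum_shift {N : ℕ} (f : ℕ → ℂ) (h : f N = f 0) :
    ∑ n ∈ range N, f (n + 1) = ∑ n ∈ range N, f n := by
  have h1 := sum_range_succ f N
  have h2 := sum_range_succ' f N
  rw [h1, h] at h2
  exact (add_right_cancel h2).symm

/-- recurrence in `v` -/
lemma F_v {N : ℕ} (hN : 0 < N) {z : ℂ} (hz : IsPrimitiveRoot z N) {u v : ℂ}
    (huv : u ^ N + v ^ N = 1) (hu : u ^ N ≠ 1) :
    F N z u (z * v) * u = F N z u v * (1 - v) := by
  have hne := om_ne hN hz.pow_eq_one hu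
  have hs := sum_shift (N := N) (fun n => v ^ n / om z u n * (1 - u * z ^ n)) (by
    simp only [om_N hN hz, hz.pow_eq_one]
    have : v ^ N = 1 - u ^ N := by linear_combination huv
    rw [this, div_self (by rw [sub_ne_zero]; exact hu.symm)]
    simp [om])
  have e1 : ∑ n ∈ range N, v ^ (n+1) / om z u (n+1) * (1 - u * z ^ (n+1)) = F N z u v * v := by
    rw [F, sum_mul]
    refine sum_congr rfl fun n _ => ?_
    have := hne n
    have := lin_ne hN hz.pow_eq_one hu (n+1)
    rw [om_succ, pow_succ]
    field_simp
  have e2 : ∑ n ∈ range N, v ^ n / om z u n * (1 - u * z ^ n)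
      = F N z u v - F N z u (z * v) * u := by
    rw [F, F, sum_mul, ← sum_sub_distrib]
    refine sum_congr rfl fun n _ => ?_
    rw [mul_pow]; ring
  rw [e1, e2] at hs
  linear_combination hs

/-- recurrence in `u` -/
lemma F_u {N : ℕ} (hN : 0 < N) {z : ℂ} (hz : IsPrimitiveRoot z N) {u v : ℂ}
    (huv : u ^ N + v ^ N = 1) (hu : u ^ N ≠ 1) :
    F N z (z * u) v * v = (1 - z * u) * F N z u v := by
  have hne := om_ne hN hz.pow_eq_one hu
  have hs := sum_shift (N := N) (fun n => v ^ n / om z u n) (by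
    simp only [om_N hN hz]
    have : v ^ N = 1 - u ^ N := by linear_combination huv
    rw [this, div_self (by rw [sub_ne_zero]; exact hu.symm)]
    simp [om])
  rw [F, F, ← hs, sum_mul, mul_sum]
  refine sum_congr rfl fun n _ => ?_
  have h1 : om z u (n+1) = (1 - z * u) * om z (z * u) n := by
    rw [om, prod_range_succ', mul_comm, om]
    congr 1
    · ring
    · exact prod_congr rfl fun j _ => by ring
  have h2 := hne (n+1)
  rw [h1] at h2
  rw [h1]
  have := left_ne_zero_of_mul h2
  have := right_ne_zero_of_mul h2
  rw [pow_succ]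
  field_simp

/-- iterate downward -/
lemma F_down {N : ℕ} (hN : 0 < N) {z w : ℂ} (hz : IsPrimitiveRoot z N) (hzw : z * w = 1) {u v : ℂ}
    (huv : u ^ N + v ^ N = 1) (hu : u ^ N ≠ 1) (p : ℕ) :
    F N z u (w ^ p * v) * om w v p = F N z u v * u ^ p := by
  have hw : w ^ N = 1 := by
    have := hz.pow_eq_one
    have h2 : (z * w) ^ N = 1 := by rw [hzw, one_pow]
    rwa [mul_pow, this, one_mul] at h2
  induction p with
  | zero => simp [om]
  | succ p ih =>
    have h := F_v hN hz (u := u) (v := w ^ (p+1) * v) (by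
      rw [mul_pow, ← pow_mul, mul_comm (p+1), pow_mul, hw, one_pow, one_mul, huv]) hu
    have e : z * (w ^ (p+1) * v) = w ^ p * v := by
      rw [pow_succ]; linear_combination w ^ p * v * hzw
    rw [e] at h
    rw [om_succ]
    linear_combination (-om w v p) * h + u * ih

lemma F_sum {N : ℕ} (hN : 0 < N) {z w : ℂ} (hw : IsPrimitiveRoot w N) (u v : ℂ) :
    ∑ p ∈ range N, F N z u (w ^ p * v) = N := by
  simp only [F]
  rw [sum_comm, sum_eq_single 0]
  · simp [om]
  · intro n hn h0
    have : ∀ p, (w ^ p * v) ^ n / om z u n = (w ^ n) ^ p * (v ^ n / om z u n) := by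
      intro p; rw [mul_pow, ← pow_mul, ← pow_mul, mul_comm n p]; ring
    simp only [this]
    rw [← sum_mul]
    have h1 : w ^ n ≠ 1 := hw.pow_ne_one_of_pos_of_lt h0 (mem_range.1 hn)
    have h2 := geom_sum_eq h1 N
    rw [h2, ← pow_mul, mul_comm n N, pow_mul, hw.pow_eq_one]
    simp
  · intro h; exact absurd (mem_range.2 hN) h

lemma F_mul {N : ℕ} (hN : 0 < N) {z w : ℂ} (hz : IsPrimitiveRoot z N) (hw : IsPrimitiveRoot w N)
    (hzw : z * w = 1) {u v : ℂ}
    (huv : u ^ N + v ^ N = 1) (hu : u ^ N ≠ 1) (hv : v ^ N ≠ 1) :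
    F N z u v * F N w v u = N := by
  rw [← F_sum hN hw u v (z := z), F, F, mul_sum]
  refine sum_congr rfl fun p _ => ?_
  have := F_down hN hz hzw huv hu p
  rw [← mul_div_assoc, div_eq_iff (om_ne hN hw.pow_eq_one hv p), this, F]

lemma G_shift {N : ℕ} (hN : 0 < N) {z w : ℂ} (hw : IsPrimitiveRoot w N)
    (hzw : z * w = 1) (u : ℂ) :
    G N w (z * u) * (1 - z * u) ^ N = G N w u * (1 - u ^ N) := by
  rw [← prod_lin hN hw u]
  obtain ⟨M, rfl⟩ : ∃ M, N = M + 1 := ⟨N - 1, by omega⟩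
  have hz : z = w ^ M := by
    have := hw.pow_eq_one
    rw [pow_succ] at this
    have hw0 : w ≠ 0 := right_ne_zero_of_mul (by rw [hzw]; exact one_ne_zero : z * w ≠ 0)
    exact mul_right_cancel₀ hw0 (hzw.trans this.symm)
  have e : ∀ j, z * u * w ^ (j+1) = u * w ^ j := fun j => by
    rw [pow_succ]; linear_combination u * w ^ j * hzw
  rw [G, G, prod_range_succ', ← prod_mul_distrib]
  simp only [e, ← pow_succ]
  rw [prod_range_succ _ M]
  rw [hz]
  simp [mul_comm]

lemma prod_om {N : ℕ} {z w : ℂ} (hz : z ^ N = 1) 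
    (hzw : z * w = 1) (v : ℂ) :
    ∏ p ∈ range N, om w v p = G N z v := by
  have key : ∀ M, ∏ p ∈ range M, om w v p = ∏ j ∈ range M, (1 - v * w ^ (M - j)) ^ j := by
    intro M
    induction M with
    | zero => simp
    | succ M ih =>
      rw [prod_range_succ, ih, prod_range_succ', om,
        ← prod_range_reflect (fun j => 1 - v * w ^ (j+1)), pow_zero, mul_one,
        ← prod_mul_distrib]
      refine prod_congr rfl fun j hj => ?_
      have := mem_range.1 hj
      rw [show M + 1 - (j+1) = M - j by omega, show M - 1 - j + 1 = M - j by omega]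
      exact (pow_succ _ _).symm
  rw [key, G]
  refine prod_congr rfl fun j hj => ?_
  have hj := mem_range.1 hj
  have h1 : w ^ (N - j) = z ^ j := by
    have h2 : z ^ (N - j) * z ^ j = 1 := by rw [← pow_add, Nat.sub_add_cancel hj.le, hz]
    have h3 : z ^ (N - j) * w ^ (N - j) = 1 := by rw [← mul_pow, hzw, one_pow]
    exact mul_left_cancel₀ (left_ne_zero_of_mul (by rw [h2]; exact one_ne_zero)) (h3.trans h2.symm)
  rw [h1]

lemma expand_of_inv {R : Type*} [CommRing R] [IsDomain R] {N : ℕ} (hN : 0 < N) {r : R}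
    (hr : IsPrimitiveRoot r N) (q : Polynomial R)
    (hq : q.comp (Polynomial.C r * Polynomial.X) = q) : ∃ H, q = Polynomial.expand R N H := by
  refine ⟨Polynomial.contract N q, ?_⟩
  ext n
  rw [Polynomial.coeff_expand hN]
  split_ifs with h
  · rw [Polynomial.coeff_contract hN.ne', Nat.div_mul_cancel h]
  · have h1 := congrArg (fun p => Polynomial.coeff p n) hq
    simp only [Polynomial.comp_C_mul_X_coeff] at h1
    by_contra h2
    apply h
    rw [← hr.pow_eq_one_iff_dvd]
    exact mul_left_cancel₀ h2 (by rw [h1, mul_one])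

/-- cleared denominators -/
noncomputable def P (N : ℕ) (z u v : ℂ) : ℂ :=
  ∑ n ∈ range N, v ^ n * ∏ j ∈ Ico (n+1) N, (1 - u * z ^ j)

open Polynomial in
lemma exists_Dt {N : ℕ} (hN : 0 < N) (z : ℂ) {w : ℂ} (hw : IsPrimitiveRoot w N) :
    ∃ D : ℂ[X], ∀ u v, u ^ N + v ^ N = 1 → D.eval u = ∏ p ∈ range N, P N z u (w ^ p * v) := by
  let f : ℂ[X][X] := ∑ n ∈ range N, C (∏ j ∈ Ico (n+1) N, (1 - X * C (z ^ j))) * X ^ n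
  let q : ℂ[X][X] := ∏ p ∈ range N, f.comp (C (C (w ^ p)) * X)
  have hq : q.comp (C (C w) * X) = q := by
    simp only [q, Polynomial.prod_comp, comp_assoc]
    have e : ∀ p, (C (C (w ^ p)) * X : ℂ[X][X]).comp (C (C w) * X) = C (C (w ^ (p+1))) * X := by
      intro p
      simp only [mul_comp, C_comp, X_comp, pow_succ, C_mul, mul_assoc]
    simp only [e]
    obtain ⟨M, rfl⟩ : ∃ M, N = M + 1 := ⟨N - 1, by omega⟩
    rw [prod_range_succ, prod_range_succ' _ M, hw.pow_eq_one, pow_zero]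
  obtain ⟨H, hH⟩ := expand_of_inv hN (hw.map_of_injective (C_injective (R := ℂ))) q hq
  refine ⟨H.eval (1 - X ^ N), fun u v huv => ?_⟩
  have h1 : (H.eval (1 - X ^ N)).eval u = (q.eval (C v)).eval u := by
    rw [hH, expand_eval, ← C_pow]
    have e := fun x : ℂ[X] => (eval₂_hom (p := H) (evalRingHom u) x)
    simp only [coe_evalRingHom] at e
    rw [← e, ← e]
    congr 1
    simp only [eval_sub, eval_one, eval_pow, eval_X, eval_C]
    linear_combination -huv
  rw [h1]
  simp only [q, eval_prod, eval_comp, f, eval_finsetSum, eval_mul, eval_C, eval_pow, eval_X,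
    P, eval_sub, eval_one]
  refine prod_congr rfl fun p _ => sum_congr rfl fun n _ => ?_
  ring

lemma P_eq {N : ℕ} (hN : 0 < N) {z : ℂ} (hz : IsPrimitiveRoot z N) {u : ℂ} (hu : u ^ N ≠ 1)
    (v : ℂ) : (1 - u) * P N z u v = (1 - u ^ N) * F N z u v := by
  rw [P, F, mul_sum, mul_sum]
  refine sum_congr rfl fun n hn => ?_
  have hn := mem_range.1 hn
  have hne := om_ne hN hz.pow_eq_one hu n
  rw [← prod_lin hN hz u]
  have h1 : ∏ j ∈ range N, (1 - u * z ^ j)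
      = (1 - u) * om z u n * ∏ j ∈ Ico (n+1) N, (1 - u * z ^ j) := by
    rw [← prod_range_mul_prod_Ico _ (show n + 1 ≤ N from hn), prod_range_succ', om]
    simp only [pow_zero, mul_one]; ring
  rw [h1]
  field_simp

lemma P_one {N : ℕ} (hN : 0 < N) {z : ℂ} :
    P N z 1 0 = ∏ j ∈ Ico 1 N, (1 - z ^ j) := by
  rw [P, sum_eq_single 0]
  · simp
  · intro n _ hn; simp [hn]
  · intro h; exact absurd (mem_range.2 hN) h


open Polynomial in
lemma G_eq_eval (N : ℕ) (w u : ℂ) :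
    (∏ j ∈ range N, (1 - X * C (w ^ j)) ^ j : ℂ[X]).eval u = G N w u := by
  simp [G, eval_prod]

lemma G_ne {N : ℕ} (hN : 0 < N) {w : ℂ} (hw : w ^ N = 1) {u : ℂ} (hu : u ^ N ≠ 1) :
    G N w u ≠ 0 := prod_ne_zero_iff.2 fun _ _ => pow_ne_zero _ (lin_ne hN hw hu _)

lemma G_one_ne {N : ℕ} {w : ℂ} (hw : IsPrimitiveRoot w N) : G N w 1 ≠ 0 := by
  refine prod_ne_zero_iff.2 fun j hj => ?_
  rcases Nat.eq_zero_or_pos j with rfl | h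
  · simp
  · refine pow_ne_zero _ ?_
    rw [one_mul, sub_ne_zero]
    exact (hw.pow_ne_one_of_pos_of_lt h.ne' (mem_range.1 hj)).symm

lemma prod_pow_id {m : ℕ} {w : ℂ} (x : ℂ) (hw : x ^ (2*m+1) = w) :
    ∏ p ∈ range (2*m+1), x ^ p = w ^ m := by
  have hs : ∑ p ∈ range (2*m+1), p = (2*m+1) * m := by
    have := sum_range_id_mul_two (2*m+1)
    have h2 : (2*m+1) * (2*m+1-1) = (2*m+1)*m*2 := by rw [Nat.add_sub_cancel]; ring
    omega
  rw [prod_pow_eq_pow_sum, hs, pow_mul, hw]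

lemma infinite_ne {N : ℕ} (hN : 0 < N) : {u : ℂ | u ^ N ≠ 1}.Infinite := by
  have h : {u : ℂ | u ^ N = 1}.Finite := by
    refine ((Polynomial.nthRoots N (1:ℂ)).toFinset.finite_toSet).subset fun u hu => ?_
    simp only [Finset.mem_coe, Multiset.mem_toFinset]
    rw [Polynomial.mem_nthRoots hN]
    exact hu
  exact h.infinite_compl

open Polynomial in
lemma exists_T {m N : ℕ} (hNm : N = 2 * m + 1) {z w : ℂ} (hz : IsPrimitiveRoot z N)
    (hw : IsPrimitiveRoot w N) (hzw : z * w = 1) :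
    ∃ T : ℂ[X], T.eval 1 = G N w 1 ∧ ∀ u v, u ^ N + v ^ N = 1 → u ^ N ≠ 1 →
      T.eval (u ^ N) = (∏ p ∈ range N, F N z u (w ^ p * v)) * G N w u := by
  have hN : 0 < N := by omega
  obtain ⟨D, hD⟩ := exists_Dt hN z hw
  set Gp : ℂ[X] := ∏ j ∈ range N, (1 - X * C (w ^ j)) ^ j with hGp
  have hG : ∀ u, Gp.eval u = G N w u := G_eq_eval N w
  set E : ℂ[X] := (X - C 1) ^ N * (D * Gp) with hEdef
  have hEv : ∀ u v, u ^ N + v ^ N = 1 → u ^ N ≠ 1 → E.eval u =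
      (u ^ N - 1) ^ N * ((∏ p ∈ range N, F N z u (w ^ p * v)) * G N w u) := by
    intro u v huv hu
    have h1 : (u - 1) ^ N * ∏ p ∈ range N, P N z u (w ^ p * v)
        = (u ^ N - 1) ^ N * ∏ p ∈ range N, F N z u (w ^ p * v) := by
      conv_lhs => rw [← card_range N, ← prod_const, card_range, ← prod_mul_distrib]
      conv_rhs => rw [← card_range N, ← prod_const, card_range, ← prod_mul_distrib]
      refine prod_congr rfl fun p _ => ?_
      linear_combination -(P_eq hN hz hu (w ^ p * v))
    rw [hEdef, eval_mul, eval_mul, hG, hD u v huv, eval_pow, eval_sub, eval_X, eval_C]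
    linear_combination G N w u * h1
  have hinv : E.comp (C z * X) = E := by
    apply eq_of_infinite_eval_eq
    refine (infinite_ne hN).mono fun u hu => ?_
    have hu : u ^ N ≠ 1 := hu
    obtain ⟨v, hv⟩ := IsAlgClosed.exists_pow_nat_eq (1 - u ^ N) hN
    have huv : u ^ N + v ^ N = 1 := by rw [hv]; ring
    have hzu : (z * u) ^ N = u ^ N := by rw [mul_pow, hz.pow_eq_one, one_mul]
    have hvN : v ^ N ≠ 0 := by rw [hv, sub_ne_zero]; exact hu.symm
    have hl : 1 - z * u ≠ 0 := by
      have := lin_ne hN hz.pow_eq_one hu 1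
      rwa [pow_one, mul_comm] at this
    have heval : eval u (C z * X) = z * u := by simp
    show (E.comp (C z * X)).eval u = E.eval u
    rw [eval_comp, heval, hEv _ v (by rw [hzu, huv]) (by rw [hzu]; exact hu),
      hEv u v huv hu, hzu]
    congr 1
    have h1 : (∏ p ∈ range N, F N z (z * u) (w ^ p * v)) * v ^ N
        = (1 - z * u) ^ N * ∏ p ∈ range N, F N z u (w ^ p * v) := by
      have hpw : ∏ p ∈ range N, w ^ p = 1 := by
        subst hNm
        rw [prod_pow_id w hw.pow_eq_one, one_pow]
      have e : v ^ N = ∏ p ∈ range N, (w ^ p * v) := by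
        rw [prod_mul_distrib, hpw, prod_const, card_range, one_mul]
      rw [e, ← prod_mul_distrib]
      conv_rhs => rw [← card_range N, ← prod_const, card_range, ← prod_mul_distrib]
      refine prod_congr rfl fun p _ => ?_
      apply F_u hN hz _ hu
      rw [mul_pow, ← pow_mul, mul_comm p, pow_mul, hw.pow_eq_one, one_pow, one_mul, huv]
    have h2 := G_shift hN hw hzw u
    rw [← hv] at h2
    apply mul_right_cancel₀ (mul_ne_zero hvN (pow_ne_zero N hl))
    linear_combination (G N w (z*u) * (1 - z * u) ^ N) * h1
      + (1 - z * u) ^ N * (∏ p ∈ range N, F N z u (w ^ p * v)) * h2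
  obtain ⟨Y, hY⟩ := expand_of_inv hN hz E hinv
  have hD1 : D.eval 1 = (N : ℂ) ^ N := by
    rw [hD 1 0 (by simp [hN.ne'])]
    simp only [mul_zero]
    rw [prod_const, card_range, P_one hN]
    congr 1
    obtain ⟨M, rfl⟩ : ∃ M, N = M + 1 := ⟨N - 1, by omega⟩
    rw [prod_Ico_eq_prod_range]
    have := hz.prod_one_sub_pow_eq_order
    push_cast
    rw [← this]
    exact prod_congr rfl fun j _ => by rw [add_comm]
  have hN0 : (N : ℂ) ≠ 0 := by exact_mod_cast hN.ne'
  have hDG : (D * Gp).eval 1 ≠ 0 := by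
    rw [eval_mul, hD1, hG]
    exact mul_ne_zero (pow_ne_zero _ hN0) (G_one_ne hw)
  have hE0 : E ≠ 0 := by
    refine mul_ne_zero (pow_ne_zero _ (X_sub_C_ne_zero 1)) ?_
    rintro h; rw [h] at hDG; simp at hDG
  have hY0 : Y ≠ 0 := by rintro rfl; simp at hY; exact hE0 hY
  obtain ⟨Z, hZ, hZ1⟩ := exists_eq_pow_rootMultiplicity_mul_and_not_dvd Y hY0 1
  set k := rootMultiplicity 1 Y
  rw [dvd_iff_isRoot, IsRoot] at hZ1
  set S : ℂ[X] := ∑ i ∈ range N, X ^ i with hS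
  have hS1 : S.eval 1 = N := by simp [hS, eval_finsetSum]
  have hXS : (X ^ N - C 1 : ℂ[X]) = (X - C 1) * S := by
    rw [C_1, hS, mul_comm, geom_sum_mul]
  have hexp : ∀ (a : ℕ) (Q : ℂ[X]), expand ℂ N ((X - C 1) ^ a * Q) =
      (X - C 1) ^ a * (S ^ a * expand ℂ N Q) := by
    intro a Q
    rw [map_mul, map_pow, map_sub, expand_X, expand_C, hXS, mul_pow]; ring
  have hkN : N ≤ k := by
    by_contra hlt
    push Not at hlt
    rw [hZ, hexp, hEdef, show N = k + (N - k) by omega, pow_add, mul_assoc,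
      ← show N = k + (N - k) by omega] at hY
    have h2 := congrArg (eval 1) (mul_left_cancel₀ (pow_ne_zero _ (X_sub_C_ne_zero (1:ℂ))) hY)
    rw [eval_mul, eval_pow, eval_mul (p := S ^ k), eval_pow, hS1, expand_eval, one_pow, eval_sub,
      eval_X, eval_C, sub_self, zero_pow (by omega), zero_mul] at h2
    exact mul_ne_zero (pow_ne_zero _ hN0) hZ1 h2.symm
  obtain ⟨T, hT⟩ : ∃ T, Y = (X - C 1) ^ N * T := by
    refine ⟨(X - C 1) ^ (k - N) * Z, ?_⟩
    rw [← mul_assoc, ← pow_add, Nat.add_sub_cancel' hkN]; exact hZ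
  rw [hT] at hY
  refine ⟨T, ?_, ?_⟩
  · rw [hexp, hEdef] at hY
    have h2 := congrArg (eval 1) (mul_left_cancel₀ (pow_ne_zero _ (X_sub_C_ne_zero (1:ℂ))) hY)
    rw [eval_mul, eval_mul, eval_pow, hS1, expand_eval, one_pow, hD1, hG] at h2
    exact (mul_left_cancel₀ (pow_ne_zero _ hN0) h2).symm
  · intro u v huv hu
    have h2 := congrArg (eval u) hY
    rw [hEv u v huv hu, expand_eval, eval_mul, eval_pow, eval_sub, eval_X, eval_C] at h2
    exact (mul_left_cancel₀ (pow_ne_zero _ (sub_ne_zero.2 hu)) h2).symm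

lemma prod_F {m N : ℕ} (hNm : N = 2 * m + 1) {z w : ℂ} (hz : IsPrimitiveRoot z N)
    (hzw : z * w = 1) {u v : ℂ}
    (huv : u ^ N + v ^ N = 1) (hu : u ^ N ≠ 1) :
    (∏ p ∈ range N, F N z u (w ^ p * v)) * G N z v = F N z u v ^ N * (u ^ N) ^ m := by
  have hN : 0 < N := by omega
  rw [← prod_om hz.pow_eq_one hzw, ← prod_mul_distrib]
  rw [prod_congr rfl fun p _ => F_down hN hz hzw huv hu p, prod_mul_distrib, prod_const, card_range]
  subst hNm
  rw [prod_pow_id u rfl]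

open Polynomial in
lemma key {m N : ℕ} (hNm : N = 2 * m + 1) {z w : ℂ} (hz : IsPrimitiveRoot z N)
    (hw : IsPrimitiveRoot w N) (hzw : z * w = 1) {u v : ℂ}
    (huv : u ^ N + v ^ N = 1) (hu : u ^ N ≠ 1) (hu0 : u ≠ 0) :
    F N z u v ^ N * G N w u = G N w 1 * G N z v := by
  have hN : 0 < N := by omega
  have hwz : w * z = 1 := by rw [mul_comm, hzw]
  have hN0 : (N : ℂ) ≠ 0 := by exact_mod_cast hN.ne'
  obtain ⟨T, hT1, hT⟩ := exists_T hNm hz hw hzw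
  obtain ⟨T', hT1', hT'⟩ := exists_T hNm hw hz hwz
  have hTe : ∀ u v, u ^ N + v ^ N = 1 → u ^ N ≠ 1 →
      T.eval (u ^ N) * G N z v = F N z u v ^ N * (u ^ N) ^ m * G N w u := by
    intro u v huv hu
    rw [hT u v huv hu, ← prod_F hNm hz hzw huv hu]; ring
  have hTe' : ∀ u v, u ^ N + v ^ N = 1 → u ^ N ≠ 1 →
      T'.eval (u ^ N) * G N w v = F N w u v ^ N * (u ^ N) ^ m * G N z u := by
    intro u v huv hu
    rw [hT' u v huv hu, ← prod_F hNm hw hwz huv hu]; ring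
  have hprod : T * T'.comp (1 - X) = X ^ m * (C ((N : ℂ) ^ N) * (1 - X) ^ m) := by
    apply eq_of_infinite_eval_eq
    refine (Set.Finite.infinite_compl (s := ({0, 1} : Set ℂ)) (by simp)).mono fun t ht => ?_
    simp only [Set.mem_compl_iff, Set.mem_insert_iff, Set.mem_singleton_iff, not_or] at ht
    obtain ⟨a, ha⟩ := IsAlgClosed.exists_pow_nat_eq t hN
    obtain ⟨b, hb⟩ := IsAlgClosed.exists_pow_nat_eq (1 - t) hN
    have hab : a ^ N + b ^ N = 1 := by rw [ha, hb]; ring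
    have ha1 : a ^ N ≠ 1 := by rw [ha]; exact ht.2
    have hb1 : b ^ N ≠ 1 := by rw [hb]; intro h; exact ht.1 (by linear_combination -h)
    have h1 := hTe a b hab ha1
    have h2 := hTe' b a (by rw [add_comm, hab]) hb1
    have h3 := F_mul hN hz hw hzw hab ha1 hb1
    have h4 : F N z a b ^ N * F N w b a ^ N = (N:ℂ) ^ N := by rw [← mul_pow, h3]
    have g1 := G_ne hN hz.pow_eq_one hb1
    have g2 := G_ne hN hw.pow_eq_one ha1
    rw [ha] at h1
    rw [hb] at h2
    show eval t _ = eval t _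
    simp only [eval_mul, eval_comp, eval_sub, eval_one, eval_X, eval_pow, eval_C]
    apply mul_right_cancel₀ (mul_ne_zero g1 g2)
    calc eval t T * eval (1 - t) T' * (G N z b * G N w a)
        = (eval t T * G N z b) * (eval (1 - t) T' * G N w a) := by ring
      _ = (F N z a b ^ N * F N w b a ^ N) * (t ^ m * (1 - t) ^ m) * (G N z b * G N w a) := by
          rw [h1, h2]; ring
      _ = _ := by rw [h4]; ring
  have hXT : (X : ℂ[X]) ^ m ∣ T := by
    refine prime_X.pow_dvd_of_dvd_mul_right m (b := T'.comp (1 - X)) ?_ ⟨_, hprod⟩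
    rw [X_dvd_iff, coeff_zero_eq_eval_zero, eval_comp]
    simp only [eval_sub, eval_one, eval_X, sub_zero]
    rw [hT1']; exact G_one_ne hz
  obtain ⟨S, hS⟩ := hXT
  have hS1 : S.eval 1 = G N w 1 := by rw [← hT1, hS]; simp
  rw [hS, mul_assoc] at hprod
  have hp2 := mul_left_cancel₀ (pow_ne_zero m X_ne_zero) hprod
  have h1X : (1 - X : ℂ[X]) = (X - C 1) * C (-1) := by simp
  have hdvd : (X - C 1 : ℂ[X]) ^ m ∣ T'.comp (1 - X) := by
    refine (prime_X_sub_C (1:ℂ)).pow_dvd_of_dvd_mul_left m (a := S) ?_ ?_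
    · rw [dvd_iff_isRoot, IsRoot, hS1]; exact G_one_ne hw
    · rw [hp2, h1X, mul_pow]
      exact ⟨C ((N:ℂ)^N) * C (-1) ^ m, by ring⟩
  obtain ⟨S', hS'⟩ := hdvd
  rw [hS', h1X, mul_pow] at hp2
  have hp3 : S * S' = C ((N : ℂ) ^ N * (-1) ^ m) := by
    apply mul_left_cancel₀ (pow_ne_zero m (X_sub_C_ne_zero (1:ℂ)))
    rw [C_mul, show (C ((-1 : ℂ) ^ m) : ℂ[X]) = C (-1) ^ m from C_pow]
    linear_combination hp2
  have hunit : IsUnit S := by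
    refine isUnit_of_mul_isUnit_left (y := S') ?_
    rw [hp3, isUnit_C, isUnit_iff_ne_zero]
    exact mul_ne_zero (pow_ne_zero _ hN0) (pow_ne_zero _ (by norm_num))
  obtain ⟨s, -, rfl⟩ := Polynomial.isUnit_iff.1 hunit
  rw [eval_C] at hS1
  have h := hTe u v huv hu
  rw [hS, hS1] at h
  simp only [eval_mul, eval_pow, eval_X, eval_C] at h
  have : (u ^ N) ^ m ≠ 0 := pow_ne_zero _ (pow_ne_zero _ hu0)
  apply mul_left_cancel₀ this
  linear_combination -h

lemma zeta_prim {N : ℕ} (hN : 0 < N) : IsPrimitiveRoot (zetaN N) N :=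
  Complex.isPrimitiveRoot_exp N hN.ne'

lemma gfun_pow {N : ℕ} (hN : 0 < N) (x : ℂ) : gfun N x ^ N = G N (zetaN N)⁻¹ x := by
  have hN0 : (N : ℂ) ≠ 0 := by exact_mod_cast hN.ne'
  rw [gfun, ← prod_pow, G]
  obtain ⟨M, rfl⟩ : ∃ M, N = M + 1 := ⟨N - 1, by omega⟩
  rw [prod_range_succ', pow_zero, mul_one, Nat.add_sub_cancel]
  refine prod_congr rfl fun j _ => ?_
  rw [← Complex.cpow_mul_nat, div_mul_cancel₀ _ hN0]
  have h1 : ((j : ℂ) + 1) = ((j + 1 : ℕ) : ℂ) := by push_cast; rfl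
  have h2 : zetaN (M+1) ^ (-((j : ℤ) + 1)) = (zetaN (M+1))⁻¹ ^ (j+1) := by
    rw [zpow_neg, inv_pow]; norm_cast
  rw [h1, Complex.cpow_natCast, h2]

lemma G_mul {N : ℕ} (hN : 0 < N) {z : ℂ} (hz : IsPrimitiveRoot z N) (v : ℂ) :
    G N z⁻¹ (v / z) * G N z v = (1 - v ^ N) ^ (N - 1) := by
  have hz0 : z ≠ 0 := hz.ne_zero hN.ne'
  rw [← prod_lin hN hz, ← prod_pow, G, ← prod_range_reflect, G, ← prod_mul_distrib]
  refine prod_congr rfl fun j hj => ?_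
  have hj := mem_range.1 hj
  have h : v / z * z⁻¹ ^ (N - 1 - j) = v * z ^ j := by
    have h1 : z ^ (N - 1 - j) * z ^ j * z = 1 := by
      rw [← pow_add, ← pow_succ, show N - 1 - j + j + 1 = N by omega, hz.pow_eq_one]
    rw [inv_pow]
    field_simp
    linear_combination (-v) * h1
  rw [h, ← pow_add, show N - 1 - j + j = N - 1 by omega]

lemma gfun_ne {N : ℕ} (hN : 0 < N) {x : ℂ} (h : G N (zetaN N)⁻¹ x ≠ 0) : gfun N x ≠ 0 := by
  rw [← gfun_pow hN] at h
  exact fun h0 => h (by rw [h0, zero_pow hN.ne'])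

lemma scalar {m N : ℕ} (hNm : N = 2 * m + 1) {u v : ℂ}
    (huv : u ^ N + v ^ N = 1) (hu : u ^ N ≠ 1) (hu0 : u ≠ 0) :
    ∃ c : ℕ, hfun N u * F N (zetaN N) u v * gfun N (v / zetaN N) = zetaN N ^ c * u ^ (2 * m) := by
  have hN : 0 < N := by omega
  have hz := zeta_prim hN
  have hz0 := hz.ne_zero hN.ne'
  set z := zetaN N
  have k := key hNm hz hz.inv (mul_inv_cancel₀ hz0) huv hu hu0
  have g := G_mul hN hz v
  have g1 := G_one_ne hz.inv
  have h1 : (hfun N u * F N z u v * gfun N (v / z) / u ^ (2 * m)) ^ N = 1 := by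
    rw [div_pow, div_eq_one_iff_eq (pow_ne_zero _ (pow_ne_zero _ hu0)), hfun, mul_pow, mul_pow,
      div_pow, gfun_pow hN, gfun_pow hN, gfun_pow hN]
    change G N z⁻¹ u / G N z⁻¹ 1 * _ * G N z⁻¹ _ = _
    have e : (u ^ (2 * m)) ^ N = (1 - v ^ N) ^ (N - 1) := by
      rw [← huv, add_sub_cancel_right, ← pow_mul, ← pow_mul, hNm, Nat.add_sub_cancel, mul_comm]
    rw [e, ← g]
    rw [div_mul_eq_mul_div, div_mul_eq_mul_div, div_eq_iff g1]
    linear_combination G N z⁻¹ (v / z) * k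
  have : NeZero N := ⟨hN.ne'⟩
  obtain ⟨c, -, hc⟩ := hz.eq_pow_of_pow_eq_one h1
  refine ⟨c, ?_⟩
  rw [hc, div_mul_cancel₀ _ (pow_ne_zero _ hu0)]

lemma F_up {N : ℕ} (hN : 0 < N) {z : ℂ} (hz : IsPrimitiveRoot z N) {u v : ℂ}
    (huv : u ^ N + v ^ N = 1) (hu : u ^ N ≠ 1) (p : ℕ) :
    F N z u (z ^ p * v) * u ^ p = F N z u v * om z (v / z) p := by
  have hz0 : z ≠ 0 := hz.ne_zero hN.ne'
  induction p with
  | zero => simp [om]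
  | succ p ih =>
    have h := F_v hN hz (u := u) (v := z ^ p * v) (by
      rw [mul_pow, ← pow_mul, mul_comm p, pow_mul, hz.pow_eq_one, one_pow, one_mul, huv]) hu
    have e : v / z * z ^ (p+1) = z ^ p * v := by rw [pow_succ]; field_simp
    rw [om_succ, e, pow_succ z, mul_comm (z ^ p) z, mul_assoc z, pow_succ]
    linear_combination u ^ p * h + (1 - z ^ p * v) * ih

lemma omegaZ_nat (N : ℕ) (u : ℂ) (n : ℕ) : omegaZ N u (n : ℤ) = om (zetaN N) u n := by
  simp [omegaZ, om]

lemma sum_W (m : ℕ) (u v : ℂ) (p : ZMod (2 * m + 1)) :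
    ∑ n : ZMod (2*m+1), zetaN (2*m+1) ^ ((p * n).val) * omega2 (2*m+1) u v (n.val : ℤ)
      = F (2*m+1) (zetaN (2*m+1)) u (zetaN (2*m+1) ^ p.val * v) := by
  have hz := zeta_prim (show 0 < 2 * m + 1 by omega)
  rw [F]
  refine sum_nbij' (fun n => n.val) (fun n => (n : ZMod (2*m+1))) ?_ ?_ ?_ ?_ ?_
  · intro n _; exact mem_range.2 (ZMod.val_lt n)
  · intro n _; exact mem_univ _
  · intro n _; exact ZMod.natCast_zmod_val n
  · intro n hn; exact ZMod.val_cast_of_lt (mem_range.1 hn)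
  · intro n _
    rw [omega2, omegaZ_nat, zpow_natCast, mul_pow, ← pow_mul, ZMod.val_mul,
      ← pow_eq_pow_mod _ hz.pow_eq_one]
    ring

lemma lhs (m : ℕ) (u v : ℂ) (i j k l : ZMod (2 * m + 1)) :
    ∑ α : ZMod (2 * m + 1), ∑ β : ZMod (2 * m + 1), ∑ γ : ZMod (2 * m + 1), ∑ δ : ZMod (2 * m + 1),
          zetaN (2 * m + 1) ^ ((k * α + l * β - i * γ - j * δ).val) * LN m u v γ δ α β
    = (2 * m + 1 : ℂ) * hfun (2*m+1) u * 
      zetaN (2 * m + 1) ^ (((k - i) * (j - l) + (m + 1 : ZMod (2 * m + 1)) * (j ^ 2 - l ^ 2)).val) *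
      F (2*m+1) (zetaN (2*m+1)) u (zetaN (2*m+1) ^ (l - i).val * v) := by
  have hz := zeta_prim (show 0 < 2 * m + 1 by omega)
  rw [← sum_W]
  have hz1 := hz.pow_eq_one
  set χ : AddChar (ZMod (2*m+1)) ℂ := AddChar.zmodChar (2*m+1) hz1 with hχ
  have hprim : χ.IsPrimitive := AddChar.zmodChar_primitive_of_primitive_root (2*m+1) hz
  have hval : ∀ a : ZMod (2*m+1), zetaN (2*m+1) ^ a.val = χ a := fun a =>
    (AddChar.zmodChar_apply hz1 a).symm
  have hnat : ∀ a b : ZMod (2*m+1), zetaN (2*m+1) ^ (a.val * b.val + (m + 1) * a.val ^ 2)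
      = χ (a * b + (m + 1) * a ^ 2) := fun a b => by
    rw [← AddChar.zmodChar_apply' hz1]
    congr 1
    push_cast
    rw [ZMod.natCast_zmod_val, ZMod.natCast_zmod_val]
  simp only [LN, hval, hnat]
  set h := hfun (2*m+1) u
  set W : ZMod (2*m+1) → ℂ := fun n => omega2 (2*m+1) u v (n.val : ℤ) with hW
  have hWv : ∀ n : ZMod (2*m+1), omega2 (2*m+1) u v (n.val : ℤ) = W n := fun _ => rfl
  simp only [hWv]
  have h2 : (2 * (m : ZMod (2*m+1)) + 1) = 0 := by
    have := ZMod.natCast_self (2*m+1)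
    push_cast at this; exact this
  have step : ∀ α : ZMod (2*m+1), (∑ β, ∑ γ, ∑ δ, χ (k * α + l * β - i * γ - j * δ) *
        (h * χ (α * δ + (m + 1) * α ^ 2) * W (γ - α) * if γ + δ = β then 1 else 0))
      = h * χ ((k + l - i) * α + (m + 1) * α ^ 2) * (∑ n, χ ((l - i) * n) * W n) *
        (∑ δ, χ (δ * (α + l - j))) := by
    intro α
    rw [sum_comm]
    rw [← Equiv.sum_comp (Equiv.addLeft α)]
    rw [mul_assoc, sum_mul_sum, mul_sum]
    refine sum_congr rfl fun n _ => ?_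
    rw [sum_comm, mul_sum]
    refine sum_congr rfl fun δ _ => ?_
    rw [sum_eq_single (α + n + δ)]
    · simp only [Equiv.coe_addLeft, if_true, mul_one, add_sub_cancel_left]
      have e : χ (k * α + l * (α + n + δ) - i * (α + n) - j * δ) * χ (α * δ + (m + 1) * α ^ 2)
          = χ ((k + l - i) * α + (m + 1) * α ^ 2) * (χ ((l - i) * n) * χ (δ * (α + l - j))) := by
        simp only [← AddChar.map_add_eq_mul]
        congr 1; ring
      linear_combination h * W n * e
    · intro β _ hβ
      rw [if_neg (by simpa using hβ.symm)]; simp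
    · intro hh; exact absurd (mem_univ _) hh
  simp only [step, AddChar.sum_mulShift _ hprim]
  rw [sum_eq_single (j - l)]
  · have e : (k + l - i) * (j - l) + (m + 1) * (j - l) ^ 2
        = (k - i) * (j - l) + (m + 1 : ZMod (2 * m + 1)) * (j ^ 2 - l ^ 2) := by
      linear_combination (-l * (j - l)) * h2
    rw [e, if_pos (by ring), ZMod.card]
    push_cast
    ring
  · intro α _ hα
    rw [if_neg]
    · simp
    · intro h0; apply hα; linear_combination h0
  · intro hh; exact absurd (mem_univ _) hh

end FT

theorem stmt7 (m : ℕ) (hm : 1 ≤ m) (u v : ℂ)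
    (huv : u ^ (2 * m + 1) + v ^ (2 * m + 1) = 1) (hu : u ≠ 0) (hu1 : u ^ (2 * m + 1) ≠ 1) :
    ∃ c : ℤ, ∀ i j k l : ZMod (2 * m + 1),
      ((2 * m + 1 : ℂ) ^ 2)⁻¹ *
        ∑ α : ZMod (2 * m + 1), ∑ β : ZMod (2 * m + 1), ∑ γ : ZMod (2 * m + 1), ∑ δ : ZMod (2 * m + 1),
          zetaN (2 * m + 1) ^ ((k * α + l * β - i * γ - j * δ).val) * LN m u v γ δ α β
      = zetaN (2 * m + 1) ^ c *
          ((2 * m + 1 : ℂ)⁻¹ * (gfun (2 * m + 1) (v / zetaN (2 * m + 1)))⁻¹ * u ^ (2 * m) *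
            zetaN (2 * m + 1) ^ (((k - i) * (j - l) + (m + 1 : ZMod (2 * m + 1)) * (j ^ 2 - l ^ 2)).val) /
            omega2 (2 * m + 1) (v / zetaN (2 * m + 1)) u (((l - i).val : ℤ))) := by
  have hN : 0 < 2 * m + 1 := by omega
  obtain ⟨c, hc⟩ := FT.scalar rfl huv hu1 hu
  have hz := FT.zeta_prim hN
  refine ⟨c, fun i j k l => ?_⟩
  rw [FT.lhs, omega2, FT.omegaZ_nat, zpow_natCast, zpow_natCast]
  have hup := FT.F_up hN hz huv hu1 (l - i).val
  have hN0 : (2 * m + 1 : ℂ) ≠ 0 := by exact_mod_cast hN.ne'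
  have hg : gfun (2*m+1) (v / zetaN (2*m+1)) ≠ 0 := by
    apply FT.gfun_ne hN
    have h1 := FT.G_mul hN hz v
    refine left_ne_zero_of_mul (b := FT.G (2*m+1) (zetaN (2*m+1)) v) ?_
    rw [h1, ← huv, add_sub_cancel_right]
    exact pow_ne_zero _ (pow_ne_zero _ hu)
  generalize zetaN (2 * m + 1) ^
    (((k - i) * (j - l) + (m + 1 : ZMod (2 * m + 1)) * (j ^ 2 - l ^ 2)).val) = A
  generalize (l - i).val = p at *
  have hup0 : u ^ p ≠ 0 := pow_ne_zero _ hu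
  rw [eq_div_of_mul_eq hup0 hup, div_div_eq_mul_div]
  field_simp
  linear_combination A * FT.om (zetaN (2*m+1)) (v / zetaN (2*m+1)) p * hc
end

section
/- Let u, v ∈ ℂ with u^N + v^N = 1, u ≠ 0 and u^N ≠ 1. Define endomorphisms Ã and B̃ of ℂ^N ⊗ ℂ^N (indices in ℤ/N) by Ã^{i,j}_{k,l} := N^{−1} g(v/ζ)^{−1} u^{N−1} ζ^{(k−i)(j−l) + (m+1)(j²−l²)} / ω(v/ζ, u | l−i) and B̃^{i,j}_{k,l} := g(v/ζ) [v] u^{1−N} ζ^{(k−i)(l−j) + (m+1)(j²−l²)} ω(v, u | j−k). Then Ã ∘ B̃ = Id, i.e. Σ_{k,l ∈ ℤ/N} Ã^{i,j}_{k,l} B̃^{k,l}_{p,q} = δ_N(i−p) δ_N(j−q) for all i, j, p, q ∈ ℤ/N. -/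
open Finset

noncomputable def Atil (m : ℕ) (u v : ℂ) (i j k l : ZMod (2 * m + 1)) : ℂ :=
  (2 * m + 1 : ℂ)⁻¹ * (gfun (2 * m + 1) (v / zetaN (2 * m + 1)))⁻¹ * u ^ (2 * m) *
    zetaN (2 * m + 1) ^ (((k - i) * (j - l) + (m + 1 : ZMod (2 * m + 1)) * (j ^ 2 - l ^ 2)).val) /
    omega2 (2 * m + 1) (v / zetaN (2 * m + 1)) u (((l - i).val : ℤ))

noncomputable def Btil (m : ℕ) (u v : ℂ) (i j k l : ZMod (2 * m + 1)) : ℂ :=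
  gfun (2 * m + 1) (v / zetaN (2 * m + 1)) * brk (2 * m + 1) v * u ^ ((1 : ℤ) - (2 * m + 1)) *
    zetaN (2 * m + 1) ^ (((k - i) * (l - j) + (m + 1 : ZMod (2 * m + 1)) * (j ^ 2 - l ^ 2)).val) *
    omega2 (2 * m + 1) v u (((j - k).val : ℤ))


section aux
variable {N : ℕ} [NeZero N]

lemma aux_prim : IsPrimitiveRoot (zetaN N) N := Complex.isPrimitiveRoot_exp N (NeZero.ne N)

lemma aux_psi_nat (n : ℕ) : (ZMod.stdAddChar ((n : ℕ) : ZMod N) : ℂ) = zetaN N ^ n := by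
  have := ZMod.stdAddChar_coe (N := N) (n : ℤ)
  rw [Int.cast_natCast] at this
  rw [this, zetaN, ← Complex.exp_nat_mul]
  congr 1
  push_cast
  ring

lemma aux_psi_val (x : ZMod N) : zetaN N ^ x.val = (ZMod.stdAddChar x : ℂ) := by
  rw [← aux_psi_nat, ZMod.natCast_zmod_val]

lemma aux_sum (b : ZMod N) :
    ∑ x : ZMod N, (ZMod.stdAddChar (x * b) : ℂ) = if b = 0 then (N : ℂ) else 0 := by
  have := AddChar.sum_mulShift (R' := ℂ) b (ZMod.isPrimitive_stdAddChar N)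
  rw [this]
  simp [ZMod.card]

lemma aux_sum_pow (e : ℕ) :
    ∑ x : ZMod N, (zetaN N ^ x.val) ^ e = if (e : ZMod N) = 0 then (N : ℂ) else 0 := by
  rw [← aux_sum]
  refine Finset.sum_congr rfl fun x _ => ?_
  rw [aux_psi_val, ← AddChar.map_nsmul_eq_pow, nsmul_eq_mul, mul_comm]

lemma aux_poly (c : ℕ → ℂ) (d : ℕ) : ∀ e : ℕ, 0 < e → e + d < N →
    ∑ x : ZMod N, (zetaN N ^ x.val) ^ e * ∏ j ∈ range d, (1 - c j * zetaN N ^ x.val) = 0 := by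
  induction d with
  | zero =>
    intro e he h
    simp only [range_zero, prod_empty, mul_one]
    rw [aux_sum_pow, if_neg]
    rw [ZMod.natCast_eq_zero_iff]
    intro hd
    have := Nat.le_of_dvd he hd
    omega
  | succ d ih =>
    intro e he h
    have h1 := ih e he (by omega)
    have h2 := ih (e + 1) (by omega) (by omega)
    have : ∀ x : ZMod N, (zetaN N ^ x.val) ^ e *
        ∏ j ∈ range (d + 1), (1 - c j * zetaN N ^ x.val) =
        (zetaN N ^ x.val) ^ e * ∏ j ∈ range d, (1 - c j * zetaN N ^ x.val) -
        c d * ((zetaN N ^ x.val) ^ (e + 1) * ∏ j ∈ range d, (1 - c j * zetaN N ^ x.val)) := by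
      intro x
      rw [prod_range_succ]
      ring
    simp_rw [this]
    rw [sum_sub_distrib, ← mul_sum, h1, h2]
    simp

lemma aux_full (a : ℂ) : ∏ j ∈ range N, (1 - a * zetaN N ^ j) = 1 - a ^ N := by
  have := X_pow_sub_C_eq_prod (aux_prim (N := N)) (α := a) (NeZero.pos N) rfl
  have := congrArg (Polynomial.eval 1) this
  simp only [Polynomial.eval_sub, Polynomial.eval_pow, Polynomial.eval_X, Polynomial.eval_C,
    one_pow, Polynomial.eval_prod] at this
  rw [this]
  exact prod_congr rfl fun j _ => by ring

lemma aux_ne {v : ℂ} (hv : v ^ N ≠ 1) (k : ℤ) : 1 - v * zetaN N ^ k ≠ 0 := by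
  intro h
  apply hv
  have h1 : v * zetaN N ^ k = 1 := by linear_combination -h
  have h2 : (v * zetaN N ^ k) ^ N = 1 := by rw [h1, one_pow]
  have h3 : (zetaN N ^ k) ^ N = 1 := by
    rw [← zpow_natCast, ← zpow_mul, mul_comm, zpow_mul, zpow_natCast, aux_prim.pow_eq_one, one_zpow]
  rwa [mul_pow, h3, mul_one] at h2

lemma aux_ne' {v : ℂ} (hv : v ^ N ≠ 1) (k : ℕ) : 1 - v * zetaN N ^ k ≠ 0 := by
  simpa using aux_ne hv (k : ℤ)

lemma aux_zne : zetaN N ≠ 0 := aux_prim.ne_zero (NeZero.ne N)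

lemma aux_g {v : ℂ} (hv : v ^ N ≠ 1) : gfun N (v / zetaN N) ≠ 0 := by
  unfold gfun
  rw [prod_ne_zero_iff]
  intro j _
  rw [Ne, Complex.cpow_eq_zero_iff, not_and_or]
  left
  have := aux_ne (N := N) hv (-((j : ℤ) + 1) - 1)
  rwa [zpow_sub_one₀ aux_zne, ← mul_assoc, mul_right_comm, ← div_eq_mul_inv] at this

/-- the product `(1-v)(1-vζ)...(1-vζ^(n-1))` divided by `u^n` -/
noncomputable def auxK (N : ℕ) (u v : ℂ) (n : ℕ) : ℂ :=
  (∏ j ∈ range n, (1 - v * zetaN N ^ j)) / u ^ n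

lemma aux_omega (u v : ℂ) (n : ℕ) :
    omega2 N v u (n : ℤ) = u ^ n / ∏ j ∈ range n, (1 - v * zetaN N ^ (j + 1)) := by
  simp [omega2, omegaZ]

lemma aux_omega' (u v : ℂ) (n : ℕ) : (omega2 N (v / zetaN N) u (n : ℤ))⁻¹ = auxK N u v n := by
  rw [aux_omega, inv_div, auxK]
  congr 1
  refine prod_congr rfl fun j _ => ?_
  rw [pow_succ', ← mul_assoc, div_mul_cancel₀ _ aux_zne]

lemma aux_K_add {u v : ℂ} (hu : u ≠ 0) (h : u ^ N + v ^ N = 1) (n : ℕ) :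
    auxK N u v (n + N) = auxK N u v n := by
  have hf := aux_full (N := N) (v * zetaN N ^ n)
  rw [mul_pow, ← pow_mul, mul_comm n N, pow_mul, aux_prim.pow_eq_one, one_pow, mul_one] at hf
  have hp : u ^ N = 1 - v ^ N := by linear_combination h
  simp_rw [mul_assoc, ← pow_add] at hf
  rw [auxK, auxK, prod_range_add, hf, pow_add, ← hp]
  field_simp

lemma aux_K_mod {u v : ℂ} (hu : u ≠ 0) (h : u ^ N + v ^ N = 1) (n : ℕ) :
    auxK N u v (n % N) = auxK N u v n := by
  have : ∀ k r : ℕ, auxK N u v (r + N * k) = auxK N u v r := by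
    intro k r
    induction k with
    | zero => simp
    | succ k ih => rw [mul_add, mul_one, ← add_assoc, aux_K_add hu h, ih]
  conv_rhs => rw [← Nat.mod_add_div n N, this]

lemma aux_key {u v : ℂ} (hu : u ≠ 0) (hv : v ^ N ≠ 1) (n d : ℕ) :
    auxK N u v (n + (d + 1)) * omega2 N v u (n : ℤ) =
      (1 - v) / u ^ (d + 1) * ∏ j ∈ range d, (1 - v * zetaN N ^ (1 + j) * zetaN N ^ n) := by
  have hP : ∏ j ∈ range n, (1 - v * zetaN N ^ (j + 1)) ≠ 0 :=
    prod_ne_zero_iff.mpr fun j _ => aux_ne' hv _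
  have e : n + (d + 1) = (n + 1) + d := by ring
  rw [auxK, aux_omega, pow_add u n (d + 1), e, prod_range_add, prod_range_succ' _ n]
  have : ∏ x ∈ range d, (1 - v * zetaN N ^ (n + 1 + x)) =
      ∏ j ∈ range d, (1 - v * zetaN N ^ (1 + j) * zetaN N ^ n) :=
    prod_congr rfl fun j _ => by ring
  rw [this]
  generalize ∏ j ∈ range d, (1 - v * zetaN N ^ (1 + j) * zetaN N ^ n) = T
  field_simp

lemma aux_key0 {u v : ℂ} (hu : u ≠ 0) (hv : v ^ N ≠ 1) (n : ℕ) :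
    auxK N u v n * omega2 N v u (n : ℤ) = (1 - v) / (1 - v * zetaN N ^ n) := by
  have hP : ∏ j ∈ range n, (1 - v * zetaN N ^ (j + 1)) ≠ 0 :=
    prod_ne_zero_iff.mpr fun j _ => aux_ne' hv _
  have hn := aux_ne' (N := N) hv n
  have h1 := prod_range_succ (fun j => 1 - v * zetaN N ^ j) n
  rw [prod_range_succ'] at h1
  rw [auxK, aux_omega, eq_div_iff hn]
  field_simp
  rw [← h1]
  simp [mul_comm]

lemma aux_geom {v : ℂ} (hv : v ^ N ≠ 1) :
    brk N v * ∑ x : ZMod N, (1 - v) / (1 - v * zetaN N ^ x.val) = 1 := by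
  have hN : (N : ℂ) ≠ 0 := Nat.cast_ne_zero.mpr (NeZero.ne N)
  have hv' : 1 - v ^ N ≠ 0 := fun h => hv (by linear_combination -h)
  have hb : (1 - v) * brk N v = (1 - v ^ N) / N := by
    have := mul_neg_geom_sum v N
    rw [brk, ← this]; ring
  have h1 : ∀ x : ZMod N, (1 - v) / (1 - v * zetaN N ^ x.val) =
      (1 - v) / (1 - v ^ N) * ∑ k ∈ range N, v ^ k * (zetaN N ^ x.val) ^ k := by
    intro x
    have := mul_neg_geom_sum (v * zetaN N ^ x.val) N
    have hz : (zetaN N ^ x.val) ^ N = 1 := by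
      rw [← pow_mul, mul_comm, pow_mul, aux_prim.pow_eq_one, one_pow]
    rw [mul_pow, hz, mul_one] at this
    simp_rw [mul_pow] at this
    have hn := aux_ne' (N := N) hv x.val
    rw [← this] at hv' ⊢
    have := right_ne_zero_of_mul hv'
    field_simp
  have h2 : ∑ x : ZMod N, ∑ k ∈ range N, v ^ k * (zetaN N ^ x.val) ^ k = N := by
    rw [sum_comm]
    simp_rw [← mul_sum, aux_sum_pow]
    rw [sum_eq_single 0]
    · simp
    · intro k hk hk0
      rw [if_neg, mul_zero]
      rw [ZMod.natCast_eq_zero_iff]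
      intro hd
      have := Nat.le_of_dvd (by omega) hd
      have := mem_range.mp hk
      omega
    · intro h
      exact absurd (mem_range.mpr (NeZero.pos N)) h
  simp_rw [h1]
  rw [← mul_sum, h2]
  calc _ = ((1 - v) * brk N v) * N / (1 - v ^ N) := by ring
    _ = 1 := by rw [hb]; field_simp

lemma aux_main {u v : ℂ} (hu : u ≠ 0) (h : u ^ N + v ^ N = 1) (hv : v ^ N ≠ 1) (i p : ZMod N) :
    brk N v * ∑ l : ZMod N, ZMod.stdAddChar ((p - i) * (-(l - p))) *
      (auxK N u v (l - i).val * omega2 N v u ((l - p).val : ℤ)) = if i = p then 1 else 0 := by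
  have hs : ∑ l : ZMod N, ZMod.stdAddChar ((p - i) * (-(l - p))) *
      (auxK N u v (l - i).val * omega2 N v u ((l - p).val : ℤ)) =
      ∑ n : ZMod N, ZMod.stdAddChar ((p - i) * (-n)) *
      (auxK N u v (n.val + (p - i).val) * omega2 N v u (n.val : ℤ)) := by
    refine Fintype.sum_equiv (Equiv.subRight p) _ _ fun l => ?_
    rw [Equiv.subRight_apply, ← aux_K_mod hu h ((l - p).val + (p - i).val), ← ZMod.val_add,
      sub_add_sub_cancel]
  rw [hs]
  split_ifs with hip
  · subst hip
    simp only [sub_self, zero_mul, AddChar.map_zero_eq_one, one_mul, ZMod.val_zero, add_zero]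
    simp_rw [aux_key0 hu hv]
    exact aux_geom hv
  · have hd : (p - i).val ≠ 0 := by
      rw [Ne, ZMod.val_eq_zero, sub_eq_zero]
      exact fun h => hip h.symm
    have hlt := ZMod.val_lt (p - i)
    obtain ⟨d, hd'⟩ := Nat.exists_eq_succ_of_ne_zero hd
    rw [Nat.succ_eq_add_one] at hd'
    have hpi : -(p - i) = ((N - (d + 1) : ℕ) : ZMod N) := by
      rw [Nat.cast_sub (by omega), ZMod.natCast_self, ← hd', ZMod.natCast_zmod_val, zero_sub]
    have hc : ∀ n : ZMod N, (ZMod.stdAddChar ((p - i) * (-n)) : ℂ) =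
        (zetaN N ^ n.val) ^ (N - (d + 1)) := by
      intro n
      rw [aux_psi_val, ← AddChar.map_nsmul_eq_pow, nsmul_eq_mul, ← hpi]
      congr 1
      ring
    have := aux_poly (N := N) (fun j => v * zetaN N ^ (1 + j)) d (N - (d + 1)) (by omega) (by omega)
    simp_rw [hc, hd', aux_key hu hv, mul_left_comm _ ((1 - v) / u ^ (d + 1))]
    rw [← mul_sum, this]
    simp

end aux

theorem stmt8 (m : ℕ) (hm : 1 ≤ m) (u v : ℂ)
    (huv : u ^ (2 * m + 1) + v ^ (2 * m + 1) = 1) (hu : u ≠ 0) (hu1 : u ^ (2 * m + 1) ≠ 1) :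
    ∀ i j p q : ZMod (2 * m + 1),
      (∑ k : ZMod (2 * m + 1), ∑ l : ZMod (2 * m + 1), Atil m u v i j k l * Btil m u v k l p q)
        = (if i = p then 1 else 0) * (if j = q then 1 else 0) := by
  intro i j p q
  have hv : v ^ (2 * m + 1) ≠ 1 := by
    intro h
    rw [h] at huv
    exact pow_ne_zero (2 * m + 1) hu (by linear_combination huv)
  have hg := aux_g (N := 2 * m + 1) hv
  have hN : (2 * m + 1 : ℂ) ≠ 0 := by exact_mod_cast Nat.succ_ne_zero (2 * m)
  have hup : u ^ (2 * m) * u ^ ((1 : ℤ) - (2 * m + 1)) = 1 := by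
    rw [← zpow_natCast, ← zpow_add₀ hu]
    have : ((2 * m : ℕ) : ℤ) + (1 - (2 * m + 1)) = 0 := by push_cast; ring
    rw [this, zpow_zero]
  have hterm : ∀ k l : ZMod (2 * m + 1), Atil m u v i j k l * Btil m u v k l p q =
      (2 * m + 1 : ℂ)⁻¹ * ZMod.stdAddChar (k * (j - q)) *
      (ZMod.stdAddChar (-(i * j) + p * q + (m + 1 : ZMod (2 * m + 1)) * (j ^ 2 - q ^ 2) - (p - i) * p) *
        (brk (2 * m + 1) v * (ZMod.stdAddChar ((p - i) * (-(l - p))) *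
      (auxK (2 * m + 1) u v (l - i).val * omega2 (2 * m + 1) v u ((l - p).val : ℤ))))) := by
    intro k l
    have hψ : (ZMod.stdAddChar (k * (j - q)) : ℂ) *
        ZMod.stdAddChar (-(i * j) + p * q + (m + 1 : ZMod (2 * m + 1)) * (j ^ 2 - q ^ 2) - (p - i) * p)
        * ZMod.stdAddChar ((p - i) * (-(l - p))) =
        ZMod.stdAddChar ((k - i) * (j - l) + (m + 1 : ZMod (2 * m + 1)) * (j ^ 2 - l ^ 2)) *
        ZMod.stdAddChar ((p - k) * (q - l) + (m + 1 : ZMod (2 * m + 1)) * (l ^ 2 - q ^ 2)) := by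
      rw [← AddChar.map_add_eq_mul, ← AddChar.map_add_eq_mul, ← AddChar.map_add_eq_mul]
      congr 1
      ring
    rw [Atil, Btil, div_eq_mul_inv, aux_omega', aux_psi_val, aux_psi_val]
    have hgg := inv_mul_cancel₀ hg
    generalize gfun (2 * m + 1) (v / zetaN (2 * m + 1)) = G at *
    generalize u ^ ((1 : ℤ) - (2 * m + 1)) = U at *
    generalize G⁻¹ = G' at *
    generalize (2 * m + 1 : ℂ)⁻¹ = N' at *
    generalize auxK _ _ _ _ = K
    generalize omega2 _ _ _ _ = W
    generalize brk _ _ = B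
    trans (G' * G) * (u ^ (2 * m) * U) * N' * B * K * W *
      (ZMod.stdAddChar ((k - i) * (j - l) + (m + 1 : ZMod (2 * m + 1)) * (j ^ 2 - l ^ 2)) *
        ZMod.stdAddChar ((p - k) * (q - l) + (m + 1 : ZMod (2 * m + 1)) * (l ^ 2 - q ^ 2)))
    · ring
    · rw [hgg, hup, ← hψ]
      ring
  simp_rw [hterm, ← mul_sum]
  rw [aux_main hu huv hv, ← sum_mul, ← mul_sum, aux_sum]
  by_cases hjq : j = q
  · subst hjq
    by_cases hip : i = p
    · subst hip
      simp
      field_simp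
    · simp [hip]
  · simp [hjq, sub_eq_zero]
end

section
/- (Core Gauss-sum identity for the braiding tensor.) For all i₁, i₂, j₁, j₂, k₁, k₂, l₁, l₂ ∈ ℤ/N one has Σ_{α,β,γ,δ ∈ ℤ/N} ζ^{(β−i₁)(α−j₂) + (δ−k₂)(γ−l₁) + (k₁−β)(γ−j₁) + (i₂−δ)(α−l₂)} = N³ · ζ^{(k₁−i₁)(l₁−j₁)} · δ_N((i₁−i₂)−(k₁−k₂)) · δ_N((l₁−l₂)−(j₁−j₂)). -/
open Finset

theorem stmt9 (m : ℕ) (hm : 1 ≤ m)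
    (i₁ i₂ j₁ j₂ k₁ k₂ l₁ l₂ : ZMod (2 * m + 1)) :
    (∑ α : ZMod (2 * m + 1), ∑ β : ZMod (2 * m + 1), ∑ γ : ZMod (2 * m + 1), ∑ δ : ZMod (2 * m + 1),
        zetaN (2 * m + 1) ^
          (((β - i₁) * (α - j₂) + (δ - k₂) * (γ - l₁) + (k₁ - β) * (γ - j₁) + (i₂ - δ) * (α - l₂)).val))
      = (2 * m + 1 : ℂ) ^ 3 * zetaN (2 * m + 1) ^ (((k₁ - i₁) * (l₁ - j₁)).val) *
          (if i₁ - i₂ = k₁ - k₂ then 1 else 0) * (if l₁ - l₂ = j₁ - j₂ then 1 else 0) := by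
  classical
  have hζ : ∀ x : ZMod (2 * m + 1), zetaN (2 * m + 1) ^ x.val = ZMod.stdAddChar x := by
    intro x
    rw [ZMod.stdAddChar_apply, ZMod.toCircle_apply, zetaN, ← Complex.exp_nat_mul]
    congr 1
    ring
  have hS : ∀ b : ZMod (2 * m + 1), ∑ x : ZMod (2 * m + 1), (ZMod.stdAddChar (x * b) : ℂ)
      = if b = 0 then (2 * m + 1 : ℂ) else 0 := by
    intro b
    rw [AddChar.sum_mulShift b (ZMod.isPrimitive_stdAddChar _), ZMod.card]
    push_cast
    rfl
  simp only [hζ]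
  have h1 : ∀ α β γ : ZMod (2 * m + 1), (∑ δ : ZMod (2 * m + 1),
      (ZMod.stdAddChar ((β - i₁) * (α - j₂) + (δ - k₂) * (γ - l₁) + (k₁ - β) * (γ - j₁)
        + (i₂ - δ) * (α - l₂)) : ℂ))
      = if γ = α + l₁ - l₂ then (2 * m + 1 : ℂ) * ZMod.stdAddChar ((β - i₁) * (α - j₂)
          - k₂ * (γ - l₁) + (k₁ - β) * (γ - j₁) + i₂ * (α - l₂)) else 0 := by
    intro α β γ
    have : ∀ δ : ZMod (2 * m + 1),
      (ZMod.stdAddChar ((β - i₁) * (α - j₂) + (δ - k₂) * (γ - l₁) + (k₁ - β) * (γ - j₁)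
        + (i₂ - δ) * (α - l₂)) : ℂ) = ZMod.stdAddChar (δ * (γ - (α + l₁ - l₂))) *
        ZMod.stdAddChar ((β - i₁) * (α - j₂)
          - k₂ * (γ - l₁) + (k₁ - β) * (γ - j₁) + i₂ * (α - l₂)) := by
      intro δ
      rw [← AddChar.map_add_eq_mul]
      congr 1
      ring
    simp only [this]
    rw [← Finset.sum_mul, hS]
    simp only [sub_eq_zero, ite_mul, zero_mul]
  simp only [h1, Finset.sum_ite_eq', Finset.sum_ite_eq, Finset.mem_univ, if_true]
  have h2 : ∀ α β : ZMod (2 * m + 1), (2 * m + 1 : ℂ) * (ZMod.stdAddChar ((β - i₁) * (α - j₂)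
          - k₂ * (α + l₁ - l₂ - l₁) + (k₁ - β) * (α + l₁ - l₂ - j₁) + i₂ * (α - l₂)) : ℂ)
      = (2 * m + 1 : ℂ) * (ZMod.stdAddChar (β * ((j₁ - j₂) - (l₁ - l₂)))
        * (ZMod.stdAddChar (α * ((k₁ - k₂) - (i₁ - i₂))) *
          ZMod.stdAddChar (i₁ * j₂ + k₂ * l₂ + k₁ * (l₁ - l₂ - j₁) - i₂ * l₂))) := by
    intro α β
    rw [← AddChar.map_add_eq_mul, ← AddChar.map_add_eq_mul]
    congr 2
    ring
  simp only [h2, ← Finset.mul_sum, ← Finset.sum_mul, hS]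
  simp only [sub_eq_zero]
  by_cases hi : i₁ - i₂ = k₁ - k₂
  · by_cases hl : l₁ - l₂ = j₁ - j₂
    · rw [if_pos hi.symm, if_pos hl.symm, if_pos hi, if_pos hl]
      have : i₁ * j₂ + k₂ * l₂ + k₁ * (l₁ - l₂ - j₁) - i₂ * l₂ = (k₁ - i₁) * (l₁ - j₁) := by
        linear_combination (l₂) * hi + i₁ * hl
      rw [this]
      ring
    · rw [if_neg (Ne.symm hl), if_neg hl]
      ring
  · rw [if_neg (Ne.symm hi), if_neg hi]
    ring
end

section
/- (C-wall tensor.) Let u₁ := 2^{1/N} (the real positive N-th root of 2) and u₂ := 2^{1/N} ζ^{m+1}; note u₁^N = u₂^N = 2, so u₁^N + (−1)^N = u₂^N + (−1)^N = 1. Then there is an integer c such that for all i, j, k, l ∈ ℤ/N: Σ_{α,β ∈ ℤ/N} L_N(u₁, −1)^{j,α}_{β,l} · (L_N(u₂, −1)^{−1})^{β,k}_{i,α} = ζ^c · (−1)^{[j−i−(m+1)]_N} · δ_N(l−k−(j−i)). -/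
open Finset

noncomputable def LNinv (m : ℕ) (u v : ℂ) (k l i j : ZMod (2 * m + 1)) : ℂ :=
  brk (2 * m + 1) u / hfun (2 * m + 1) u *
    zetaN (2 * m + 1) ^ (-((k.val * j.val + (m + 1) * k.val ^ 2 : ℕ) : ℤ)) *
    ((if i + j = l then 1 else 0) / omega2 (2 * m + 1) (u / zetaN (2 * m + 1)) v (((i - k).val : ℤ)))

lemma zetaN_prim (m : ℕ) : IsPrimitiveRoot (zetaN (2*m+1)) (2*m+1) := by
  have := Complex.isPrimitiveRoot_exp (2*m+1) (by omega)
  simpa [zetaN] using this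

lemma prod_one_sub (N : ℕ) (hN : 0 < N) (z : ℂ) (hz : IsPrimitiveRoot z N) (x : ℂ) :
    ∏ j ∈ range N, (1 - x * z ^ j) = 1 - x ^ N := by
  have h := hz.pow_sub_pow_eq_prod_sub_mul 1 x hN
  rw [one_pow] at h
  rw [h]
  have : NeZero N := ⟨hN.ne'⟩
  have : Polynomial.nthRootsFinset N (1:ℂ) = (range N).image (fun j => z ^ j) := by
    ext w
    rw [Polynomial.mem_nthRootsFinset hN]
    simp only [mem_image, mem_range]
    constructor
    · intro hw
      obtain ⟨i, hi, h⟩ := hz.eq_pow_of_pow_eq_one hw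
      exact ⟨i, hi, h⟩
    · rintro ⟨i, _, rfl⟩
      rw [← pow_mul, mul_comm, pow_mul, hz.pow_eq_one, one_pow]
  rw [this, prod_image]
  · exact prod_congr rfl fun j _ => by rw [mul_comm]
  · intro a ha b hb hab
    exact hz.pow_inj (by simpa using ha) (by simpa using hb) hab

lemma gfun_pow_s10 (N : ℕ) (hN : 0 < N) (x : ℂ) :
    gfun N x ^ N = ∏ j ∈ range N, (1 - x * (zetaN N)⁻¹ ^ j) ^ j := by
  obtain ⟨M, rfl⟩ : ∃ M, N = M + 1 := ⟨N - 1, by omega⟩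
  rw [prod_range_succ']
  simp only [pow_zero, mul_one, gfun, Nat.add_sub_cancel]
  rw [← prod_pow]
  refine prod_congr rfl fun j _ => ?_
  rw [← Complex.cpow_nat_mul]
  have : ((M + 1 : ℕ) : ℂ) ≠ 0 := by exact_mod_cast hN.ne'
  rw [mul_div_cancel₀ _ this]
  have h2 : ((j:ℂ) + 1) = ((j+1 : ℕ) : ℂ) := by push_cast; ring
  rw [h2, Complex.cpow_natCast]
  congr 3
  rw [zpow_neg, inv_pow]
  norm_cast

lemma gfun_step (N : ℕ) (hN : 0 < N) (hz : IsPrimitiveRoot (zetaN N) N) (x : ℂ) :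
    gfun N (x * zetaN N) ^ N * (1 - x * zetaN N) ^ N = (1 - x ^ N) * gfun N x ^ N := by
  have hz0 : zetaN N ≠ 0 := hz.ne_zero hN.ne'
  rw [gfun_pow_s10 N hN, gfun_pow_s10 N hN, ← prod_one_sub N hN _ hz.inv x, ← prod_mul_distrib]
  obtain ⟨M, rfl⟩ : ∃ M, N = M + 1 := ⟨N - 1, by omega⟩
  rw [prod_range_succ', prod_range_succ]
  have hl : (zetaN (M+1))⁻¹ ^ M = zetaN (M+1) := by
    have := hz.inv.pow_eq_one
    rw [pow_succ] at this
    field_simp at this ⊢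
    simpa using this
  rw [hl, pow_zero, mul_one]
  congr 1
  · refine prod_congr rfl fun j _ => ?_
    rw [pow_succ (_⁻¹), pow_succ']
    field_simp
  · rw [pow_succ']

lemma gfun_steps (N : ℕ) (hN : 0 < N) (hz : IsPrimitiveRoot (zetaN N) N) (x : ℂ) (k : ℕ) :
    gfun N (x * zetaN N ^ k) ^ N * (∏ j ∈ range k, (1 - x * zetaN N ^ (j+1))) ^ N
      = (1 - x ^ N) ^ k * gfun N x ^ N := by
  induction k with
  | zero => simp
  | succ k ih =>
    have h := gfun_step N hN hz (x * zetaN N ^ k)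
    have hx : (x * zetaN N ^ k) ^ N = x ^ N := by
      rw [mul_pow, ← pow_mul, mul_comm k, pow_mul, hz.pow_eq_one, one_pow, mul_one]
    rw [hx, mul_assoc x, ← pow_succ] at h
    rw [prod_range_succ, mul_pow, pow_succ (1 - x ^ N)]
    linear_combination (1 - x ^ N) * ih + (∏ j ∈ range k, (1 - x * zetaN N ^ (j+1))) ^ N * h

lemma gfun_ne_zero (N : ℕ) (x : ℂ) (h : ∀ j < N - 1, 1 - x * zetaN N ^ (-((j : ℤ) + 1)) ≠ 0) :
    gfun N x ≠ 0 := by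
  unfold gfun
  rw [prod_ne_zero_iff]
  intro j hj
  rw [Complex.cpow_ne_zero_iff]
  left
  exact h j (by simpa using hj)

lemma omega2_nat (N : ℕ) (u : ℂ) (n : ℕ) :
    omega2 N u (-1) (n : ℤ) = (-1) ^ n / ∏ j ∈ range n, (1 - u * zetaN N ^ (j + 1)) := by
  simp [omega2, omegaZ]

/-- The combinatorial sum. -/
lemma sum_ratio (m : ℕ) (u : ℂ) (f z : ZMod (2*m+1) → ℂ) (hf : ∀ n, f n ≠ 0)
    (hz : ∀ a b, z (a + b) = z a * z b) (hz1 : ∀ a, a ≠ 0 → z a ≠ 1)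
    (hrec : ∀ n, f (n+1) * (1 - u * z (n+1)) = - f n) (k : ℕ) (hk : k < 2*m+1) :
    ∑ n, f (n + -(k : ZMod (2*m+1))) / f n = (-1)^k * (2*m+1 : ℂ) := by
  induction k with
  | zero =>
    simp [hf]
  | succ k ih =>
    specialize ih (by omega)
    set d : ZMod (2*m+1) := -((k+1 : ℕ) : ZMod (2*m+1)) with hd
    have hd0 : d ≠ 0 := by
      rw [hd, neg_ne_zero, Ne, ZMod.natCast_eq_zero_iff]
      exact fun h => by have := Nat.le_of_dvd (by omega) h; omega
    have hd1 : -(k : ZMod (2*m+1)) = d + 1 := by rw [hd]; push_cast; ring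
    rw [hd1] at ih
    have key : ∀ n, z d * (f (n + 1 + d) / f (n+1)) - f (n + d) / f n
        = -(z d - 1) * (f (n + (d + 1)) / f n) := by
      intro n
      have h1 := hrec n
      have h2 := hrec (n + d)
      rw [show n + d + 1 = (n+1) + d by ring, hz (n+1) d] at h2
      rw [show n + (d + 1) = (n+1) + d by ring]
      have e1 := hf n
      have e2 := hf (n+1)
      field_simp
      linear_combination (z d * f (n+1+d)) * h1 - f (n+1) * h2
    have hs := Finset.sum_congr (rfl : (univ : Finset (ZMod (2*m+1))) = univ) fun n _ => key n
    rw [sum_sub_distrib, ← mul_sum, ← mul_sum, ih] at hs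
    have hsh : ∑ n, f (n + 1 + d) / f (n+1) = ∑ n, f (n + d) / f n :=
      Equiv.sum_comp (Equiv.addRight (1 : ZMod (2*m+1))) (fun n => f (n + d) / f n)
    rw [hsh] at hs
    have := hz1 d hd0
    have h3 : z d - 1 ≠ 0 := sub_ne_zero.mpr this
    apply mul_left_cancel₀ h3
    rw [pow_succ]
    linear_combination hs

lemma F_facts (m : ℕ) (u : ℂ) (hu : u ^ (2*m+1) = 2) :
    (∀ n : ℕ, 1 - u * zetaN (2*m+1) ^ n ≠ 0) ∧
    (∏ j ∈ range (2*m+1), (1 - u * zetaN (2*m+1) ^ (j+1))) = -1 := by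
  have hz := zetaN_prim m
  constructor
  · intro n h
    have : (u * zetaN (2*m+1) ^ n) ^ (2*m+1) = 2 := by
      rw [mul_pow, ← pow_mul, mul_comm n, pow_mul, hz.pow_eq_one, one_pow, mul_one, hu]
    rw [← sub_eq_zero.mp h] at this
    norm_num at this
  · have h := prod_one_sub (2*m+1) (by omega) _ hz (u * zetaN (2*m+1))
    rw [mul_pow, hz.pow_eq_one, hu] at h
    rw [← show (1 - 2 * 1 : ℂ) = -1 by norm_num, ← h]
    exact prod_congr rfl fun j _ => by rw [pow_succ', mul_assoc]

theorem stmt10 (m : ℕ) (hm : 1 ≤ m) :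
    ∃ c : ℤ, ∀ i j k l : ZMod (2 * m + 1),
      (∑ α : ZMod (2 * m + 1), ∑ β : ZMod (2 * m + 1),
          LN m ((2 : ℂ) ^ ((2 * m + 1 : ℂ))⁻¹) (-1) j α β l *
            LNinv m ((2 : ℂ) ^ ((2 * m + 1 : ℂ))⁻¹ * zetaN (2 * m + 1) ^ (m + 1)) (-1) β k i α)
        = zetaN (2 * m + 1) ^ c *
            ((-1 : ℂ) ^ ((j - i - (m + 1 : ZMod (2 * m + 1))).val) *
              (if l - k = j - i then 1 else 0)) := by
  
  set u : ℂ := (2 : ℂ) ^ ((2 * m + 1 : ℂ))⁻¹ with hu_def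
  have hu : u ^ (2*m+1) = 2 := by
    have := Complex.cpow_nat_inv_pow 2 (n := 2*m+1) (by omega)
    push_cast at this
    exact this
  clear_value u
  have hz := zetaN_prim m
  set ζ := zetaN (2*m+1) with hζ
  have hz0 : ζ ≠ 0 := hz.ne_zero (by omega)
  obtain ⟨hne, hprod⟩ := F_facts m u hu
  rw [← hζ] at hne hprod
  -- F on naturals
  let F : ℕ → ℂ := fun n => (-1) ^ n / ∏ j ∈ range n, (1 - u * ζ ^ (j + 1))
  have hFdef : ∀ n, F n = (-1) ^ n / ∏ j ∈ range n, (1 - u * ζ ^ (j + 1)) := fun n => rfl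
  have hP : ∀ n, ∏ j ∈ range n, (1 - u * ζ ^ (j + 1)) ≠ 0 := fun n =>
    prod_ne_zero_iff.mpr fun j _ => hne _
  have hF0 : ∀ n, F n ≠ 0 := fun n => div_ne_zero (pow_ne_zero _ (by norm_num)) (hP n)
  have hFs : ∀ n, F (n+1) * (1 - u * ζ ^ (n+1)) = - F n := by
    intro n
    rw [hFdef, hFdef, prod_range_succ, pow_succ]
    have := hP n
    have := hne (n+1)
    field_simp
  have hFN : F (2*m+1) = 1 := by
    rw [hFdef, hprod, pow_succ, pow_mul]; norm_num
  have hFper : ∀ n, F (n + (2*m+1)) = F n := by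
    intro n
    induction n with
    | zero => rw [zero_add, hFN]; simp [F]
    | succ n ih =>
      have h1 := hFs (n + (2*m+1))
      have h2 := hFs n
      rw [ih, show n + (2*m+1) + 1 = (n + 1) + (2*m+1) by ring, pow_add, hz.pow_eq_one, mul_one] at h1
      exact mul_right_cancel₀ (hne (n+1)) (h1.trans h2.symm)
  have hFmod : ∀ n, F (n % (2*m+1)) = F n := fun n =>
    Function.Periodic.map_mod_nat hFper n
  let f : ZMod (2*m+1) → ℂ := fun n => F n.val
  let z : ZMod (2*m+1) → ℂ := fun n => ζ ^ n.val
  have hfcast : ∀ n : ℕ, f (n : ZMod (2*m+1)) = F n := by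
    intro n; simp only [f]; rw [ZMod.val_natCast, hFmod]
  have hzcast : ∀ n : ℕ, z (n : ZMod (2*m+1)) = ζ ^ n := by
    intro n; simp only [z]; rw [ZMod.val_natCast, hz.eq_orderOf, pow_mod_orderOf]
  have hf0 : ∀ n, f n ≠ 0 := fun n => hF0 _
  have hzadd : ∀ a b, z (a + b) = z a * z b := by
    intro a b
    rw [← ZMod.natCast_zmod_val a, ← ZMod.natCast_zmod_val b, ← Nat.cast_add, hzcast, hzcast, hzcast,
      pow_add]
  have hz1 : ∀ a, a ≠ 0 → z a ≠ 1 := by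
    intro a ha h
    have h1 := (hz.pow_eq_one_iff_dvd a.val).mp h
    have h2 := ZMod.val_lt a
    have h3 : a.val = 0 := Nat.eq_zero_of_dvd_of_lt h1 h2
    exact ha ((ZMod.val_eq_zero a).mp h3)
  have hrec : ∀ n, f (n+1) * (1 - u * z (n+1)) = - f n := by
    intro n
    have h := hFs n.val
    rw [← hfcast, ← hzcast, Nat.cast_add, ZMod.natCast_zmod_val, Nat.cast_one] at h
    exact h
  have hS := sum_ratio m u f z hf0 hzadd hz1 hrec
  -- second omega
  have hom2 : ∀ n : ℕ, omega2 (2*m+1) (u * ζ ^ (m+1) / ζ) (-1) (n : ℤ) = F (n + m) / F m := by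
    intro n
    rw [omega2_nat, ← hζ, hFdef, hFdef, show n + m = m + n by ring, prod_range_add]
    have hr : ∏ j ∈ range n, (1 - u * ζ ^ (m+1) / ζ * ζ ^ (j+1))
        = ∏ j ∈ range n, (1 - u * ζ ^ (m + j + 1)) := by
      refine prod_congr rfl fun j _ => ?_
      rw [pow_succ ζ m, pow_add ζ (m+j), pow_add ζ m j, pow_succ ζ j]
      field_simp
    rw [hr]
    have h1 := hP m
    have h2 : ∏ j ∈ range n, (1 - u * ζ ^ (m + j + 1)) ≠ 0 :=
      prod_ne_zero_iff.mpr fun j _ => hne _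
    rw [pow_add]
    have h3 : (-1 : ℂ) ^ m ≠ 0 := pow_ne_zero _ (by norm_num)
    field_simp
  -- the constant
  set K : ℂ := hfun (2*m+1) u * (brk (2*m+1) (u * ζ ^ (m+1)) / hfun (2*m+1) (u * ζ ^ (m+1))) * F m
    * (2*m+1 : ℂ) with hK
  have hNne : (2*m+1 : ℂ) ≠ 0 := by exact_mod_cast (show 2*m+1 ≠ 0 by omega)
  have hg1 : gfun (2*m+1) 1 ≠ 0 := by
    apply gfun_ne_zero
    intro j hj h
    rw [one_mul, sub_eq_zero, ← hζ, zpow_neg, eq_comm, inv_eq_one] at h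
    have h' : ζ ^ (j+1) = 1 := by exact_mod_cast h
    have := Nat.le_of_dvd (by omega) ((hz.pow_eq_one_iff_dvd _).mp h')
    omega
  have hu2N : (u * ζ ^ (m+1)) ^ (2*m+1) = 2 := by
    rw [mul_pow, ← pow_mul, mul_comm (m+1), pow_mul, hz.pow_eq_one, one_pow, mul_one, hu]
  have hgne : ∀ v : ℂ, v ^ (2*m+1) = 2 → gfun (2*m+1) v ≠ 0 := by
    intro v hv
    apply gfun_ne_zero
    intro j hj h
    have hv' : v * ζ ^ (-((j:ℤ)+1)) = 1 := (sub_eq_zero.mp h).symm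
    have h2 : (ζ ^ (-((j:ℤ)+1))) ^ (2*m+1) = 1 := by
      rw [← zpow_natCast, ← zpow_mul, mul_comm, zpow_mul, zpow_natCast, hz.pow_eq_one, one_zpow]
    have h3 := congrArg (· ^ (2*m+1)) hv'
    simp only [mul_pow, h2, hv, one_pow] at h3
    norm_num at h3
  have hKN : K ^ (2*m+1) = 1 := by
    have hb : brk (2*m+1) (u * ζ ^ (m+1)) = - (2*m+1 : ℂ)⁻¹ / (1 - u * ζ ^ (m+1)) := by
      have h := mul_neg_geom_sum (u * ζ ^ (m+1)) (2*m+1)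
      rw [hu2N] at h
      have := hne (m+1)
      rw [brk, eq_div_iff this]
      push_cast
      linear_combination (2*m+1 : ℂ)⁻¹ * h
    have hK2 : K = (-1)^(m+1) * gfun (2*m+1) u / (gfun (2*m+1) (u * ζ ^ (m+1)) *
        ∏ j ∈ range (m+1), (1 - u * ζ ^ (j+1))) := by
      rw [hK, hb, hfun, hfun, hFdef, prod_range_succ, pow_succ (-1 : ℂ)]
      have e1 := hne (m+1)
      have e2 := hP m
      have e3 := hgne _ hu2N
      field_simp
    have hst := gfun_steps (2*m+1) (by omega) hz u (m+1)
    rw [← hζ, hu] at hst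
    rw [hK2, div_pow, mul_pow, mul_pow, hst, ← pow_mul, mul_comm (m+1), pow_mul, pow_succ (-1 : ℂ) (2*m),
      pow_mul]
    have e3 := hgne _ hu
    norm_num
    exact e3
  obtain ⟨c, -, hc⟩ := hz.eq_pow_of_pow_eq_one hKN
  refine ⟨c, fun i j k l => ?_⟩
  rw [zpow_natCast, hc]
  have hterm : ∀ α β : ZMod (2*m+1), LN m u (-1) j α β l * LNinv m (u * ζ ^ (m+1)) (-1) β k i α
      = (if j + α = l ∧ i + α = k then 1 else 0) *
        (hfun (2*m+1) u * (brk (2*m+1) (u * ζ ^ (m+1)) / hfun (2*m+1) (u * ζ ^ (m+1))) * F m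
          * (f (j - β) / f (i - β + m))) := by
    intro α β
    have hff : f (i - β + m) = F ((i - β).val + m) := by
      rw [← hfcast]; push_cast; rw [ZMod.natCast_zmod_val]
    have hfj : f (j - β) = omega2 (2*m+1) u (-1) (((j - β).val : ℕ) : ℤ) := by
      rw [omega2_nat]
    rw [LN, LNinv, ← hζ, hom2, hff, hfj, zpow_neg, zpow_natCast]
    have e1 : ζ ^ (β.val * α.val + (m+1) * β.val ^ 2) ≠ 0 := pow_ne_zero _ hz0
    have e2 := hF0 m
    have e3 := hF0 ((i - β).val + m)
    by_cases h1 : j + α = l <;> by_cases h2 : i + α = k <;> simp only [h1, h2, if_true, if_false,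
      and_true, and_false, zero_mul, mul_zero, zero_div, one_mul, mul_one]
    generalize ζ ^ (β.val * α.val + (m+1) * β.val ^ 2) = Z at e1
    field_simp
  simp_rw [hterm, ← mul_sum, ← sum_mul]
  have hα : ∑ α : ZMod (2*m+1), (if j + α = l ∧ i + α = k then (1:ℂ) else 0)
      = if l - k = j - i then 1 else 0 := by
    have : ∀ α : ZMod (2*m+1), (j + α = l ∧ i + α = k) ↔ (α = l - j ∧ l - k = j - i) := by
      intro α
      constructor
      · rintro ⟨rfl, rfl⟩
        constructor <;> ring
      · rintro ⟨rfl, h⟩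
        refine ⟨by ring, ?_⟩
        linear_combination h
    simp_rw [this, ite_and]
    simp
  rw [hα]
  -- the sum over β
  set e : ZMod (2*m+1) := j - i - (m + 1 : ZMod (2*m+1)) with he
  have hβ : ∑ β, f (j - β) / f (i - β + m) = (-1) ^ e.val * (2*m+1 : ℂ) := by
    have hlt := ZMod.val_lt e
    have hNz : (2 * (m : ZMod (2*m+1)) + 1) = 0 := by
      have := ZMod.natCast_self (2*m+1)
      push_cast at this
      exact this
    have h := hS (2*m - e.val) (by omega)
    have hcast : -((2*m - e.val : ℕ) : ZMod (2*m+1)) = e + 1 := by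
      rw [Nat.cast_sub (by omega), ZMod.natCast_zmod_val]
      push_cast
      linear_combination -hNz
    rw [hcast] at h
    have hpar : (-1 : ℂ) ^ (2*m - e.val) = (-1) ^ e.val := by
      apply neg_one_pow_congr
      rw [Nat.even_sub (by omega)]
      simp
    rw [hpar] at h
    rw [← h, ← Equiv.sum_comp (Equiv.subLeft (i + (m : ZMod (2*m+1))))]
    refine sum_congr rfl fun β _ => ?_
    simp only [Equiv.subLeft_apply]
    congr 2
    · rw [he]; ring
    · ring
  rw [hβ]
  ring
end

section
/- (The C-wall operator is an involution up to an N-th root of unity.) Let A be the N×N complex matrix with rows and columns indexed by ℤ/N and entries A^k_i := (2/N) · ζ^{(m+1)(k−i)} / (1 + ζ^{k−i}); the denominators are nonzero since N is odd. Then there is an integer c such that A ∘ A = ζ^c · Id. -/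
open Finset

noncomputable def Cwall (m : ℕ) (a b : ZMod (2 * m + 1)) : ℂ :=
  (2 / (2 * m + 1 : ℂ)) * zetaN (2 * m + 1) ^ (((m + 1 : ZMod (2 * m + 1)) * (a - b)).val) /
    (1 + zetaN (2 * m + 1) ^ ((a - b).val))

lemma zeta_pow_val (m : ℕ) (d : ZMod (2 * m + 1)) :
    zetaN (2 * m + 1) ^ d.val = ZMod.stdAddChar d := by
  have h : d = ((d.val : ℤ) : ZMod (2 * m + 1)) := by simp
  conv_rhs => rw [h, ZMod.stdAddChar_coe]
  rw [zetaN, ← Complex.exp_nat_mul]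
  congr 1
  push_cast
  ring

lemma geom_form (m : ℕ) (d : ZMod (2 * m + 1)) :
    2 / (1 + (ZMod.stdAddChar d : ℂ)) =
      ∑ t : ZMod (2 * m + 1), (-1 : ℂ) ^ t.val * ZMod.stdAddChar (t * d) := by
  set x : ℂ := ZMod.stdAddChar d with hx
  have hxN : x ^ (2 * m + 1) = 1 := by
    rw [hx, ← AddChar.map_nsmul_eq_pow]
    simp [-nsmul_eq_mul, ZModModule.char_nsmul_eq_zero]
  have hne : 1 + x ≠ 0 := by
    intro h
    have h1 : x = -1 := by linear_combination h
    rw [h1, Odd.neg_one_pow ⟨m, rfl⟩] at hxN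
    norm_num at hxN
  have hs : ∑ t : ZMod (2 * m + 1), (-1 : ℂ) ^ t.val * ZMod.stdAddChar (t * d)
      = ∑ n ∈ range (2 * m + 1), (-x) ^ n := by
    rw [Finset.sum_range]
    refine Finset.sum_congr rfl fun t _ => ?_
    have h : t * d = t.val • d := by simp
    rw [h, AddChar.map_nsmul_eq_pow, ← hx, ← mul_pow, neg_one_mul]
    rfl
  have hg := geom_sum_mul (-x) (2 * m + 1)
  rw [Odd.neg_pow ⟨m, rfl⟩, hxN] at hg
  rw [hs, div_eq_iff hne]
  linear_combination hg

lemma Cwall_form (m : ℕ) (a b : ZMod (2 * m + 1)) :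
    Cwall m a b = (1 / (2 * m + 1 : ℂ)) * ∑ t : ZMod (2 * m + 1),
      (-1 : ℂ) ^ t.val * ZMod.stdAddChar ((t + (m + 1 : ZMod (2 * m + 1))) * (a - b)) := by
  rw [Cwall, zeta_pow_val, zeta_pow_val]
  have := geom_form m (a - b)
  calc _ = (1 / (2 * m + 1 : ℂ)) * ((ZMod.stdAddChar ((m + 1 : ZMod (2 * m + 1)) * (a - b)) : ℂ) *
        (2 / (1 + (ZMod.stdAddChar (a - b) : ℂ)))) := by ring
    _ = _ := by
      rw [this, Finset.mul_sum]
      congr 1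
      refine Finset.sum_congr rfl fun t _ => ?_
      rw [add_mul t, AddChar.map_add_eq_mul]
      ring

theorem stmt11 (m : ℕ) (hm : 1 ≤ m) :
    ∃ c : ℤ, ∀ i k : ZMod (2 * m + 1),
      (∑ j : ZMod (2 * m + 1), Cwall m k j * Cwall m j i)
        = zetaN (2 * m + 1) ^ c * (if i = k then 1 else 0) := by
  refine ⟨0, fun i k => ?_⟩
  have hN : (2 * m + 1 : ℂ) ≠ 0 := by exact_mod_cast (Nat.succ_ne_zero (2 * m))
  have orth : ∀ b : ZMod (2 * m + 1), ∑ x : ZMod (2 * m + 1), (ZMod.stdAddChar (x * b) : ℂ)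
      = if b = 0 then (2 * m + 1 : ℂ) else 0 := by
    intro b
    have := AddChar.sum_mulShift b (ZMod.isPrimitive_stdAddChar (2 * m + 1))
    rw [this]
    simp [ZMod.card]
  have key : ∀ s t : ZMod (2 * m + 1), ∑ j : ZMod (2 * m + 1),
      ((-1 : ℂ) ^ s.val * ZMod.stdAddChar ((s + (m + 1 : ZMod (2 * m + 1))) * (k - j))) *
      ((-1 : ℂ) ^ t.val * ZMod.stdAddChar ((t + (m + 1 : ZMod (2 * m + 1))) * (j - i)))
      = if t = s then (2 * m + 1 : ℂ) * ZMod.stdAddChar ((s + (m + 1 : ZMod (2 * m + 1))) * (k - i)) else 0 := by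
    intro s t
    have h1 : ∀ j : ZMod (2 * m + 1),
      ((-1 : ℂ) ^ s.val * ZMod.stdAddChar ((s + (m + 1 : ZMod (2 * m + 1))) * (k - j))) *
      ((-1 : ℂ) ^ t.val * ZMod.stdAddChar ((t + (m + 1 : ZMod (2 * m + 1))) * (j - i)))
      = ((-1 : ℂ) ^ s.val * (-1 : ℂ) ^ t.val *
        ZMod.stdAddChar ((s + (m + 1 : ZMod (2 * m + 1))) * k - (t + (m + 1 : ZMod (2 * m + 1))) * i)) *
        ZMod.stdAddChar (j * (t - s)) := by
      intro j
      have h2 : (ZMod.stdAddChar ((s + (m + 1 : ZMod (2 * m + 1))) * (k - j)) : ℂ) *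
          ZMod.stdAddChar ((t + (m + 1 : ZMod (2 * m + 1))) * (j - i)) =
          ZMod.stdAddChar ((s + (m + 1 : ZMod (2 * m + 1))) * k - (t + (m + 1 : ZMod (2 * m + 1))) * i) *
          ZMod.stdAddChar (j * (t - s)) := by
        rw [← AddChar.map_add_eq_mul, ← AddChar.map_add_eq_mul]
        congr 1
        ring
      linear_combination (-1 : ℂ) ^ s.val * (-1 : ℂ) ^ t.val * h2
    rw [Finset.sum_congr rfl fun j _ => h1 j, ← Finset.mul_sum, orth]
    by_cases h : t = s
    · subst h
      have h3 : (-1 : ℂ) ^ t.val * (-1 : ℂ) ^ t.val = 1 := by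
        rw [← mul_pow]; simp
      rw [h3, ← mul_sub]
      simp [mul_comm]
    · simp [h, sub_eq_zero]
  have h4 : ∀ j : ZMod (2 * m + 1), Cwall m k j * Cwall m j i =
      (1 / (2 * m + 1 : ℂ)) ^ 2 * ∑ s : ZMod (2 * m + 1), ∑ t : ZMod (2 * m + 1),
      ((-1 : ℂ) ^ s.val * ZMod.stdAddChar ((s + (m + 1 : ZMod (2 * m + 1))) * (k - j))) *
      ((-1 : ℂ) ^ t.val * ZMod.stdAddChar ((t + (m + 1 : ZMod (2 * m + 1))) * (j - i))) := by
    intro j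
    rw [Cwall_form, Cwall_form, ← Finset.sum_mul_sum]
    ring
  rw [Finset.sum_congr rfl fun j _ => h4 j, ← Finset.mul_sum, Finset.sum_comm]
  have h5 : ∀ s : ZMod (2 * m + 1), (∑ j : ZMod (2 * m + 1), ∑ t : ZMod (2 * m + 1),
      ((-1 : ℂ) ^ s.val * ZMod.stdAddChar ((s + (m + 1 : ZMod (2 * m + 1))) * (k - j))) *
      ((-1 : ℂ) ^ t.val * ZMod.stdAddChar ((t + (m + 1 : ZMod (2 * m + 1))) * (j - i))))
      = (2 * m + 1 : ℂ) * ZMod.stdAddChar ((s + (m + 1 : ZMod (2 * m + 1))) * (k - i)) := by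
    intro s
    rw [Finset.sum_comm, Finset.sum_congr rfl fun t _ => key s t]
    simp
  rw [Finset.sum_congr rfl fun s _ => h5 s, ← Finset.mul_sum]
  have h6 : ∑ s : ZMod (2 * m + 1), (ZMod.stdAddChar ((s + (m + 1 : ZMod (2 * m + 1))) * (k - i)) : ℂ)
      = if k - i = 0 then (2 * m + 1 : ℂ) else 0 := by
    rw [← orth]
    exact Equiv.sum_comp (Equiv.addRight (m + 1 : ZMod (2 * m + 1)))
      (fun x => (ZMod.stdAddChar (x * (k - i)) : ℂ))
  rw [h6]
  by_cases h : i = k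
  · subst h
    simp
    field_simp
  · have : k - i ≠ 0 := fun h' => h (sub_eq_zero.mp h').symm
    simp [h, this]
end

section
/- Let i, j, k, l ∈ {0,…,N−1}. The following are equivalent: (i) [j−i−1]_N + [l−k]_N + [i−l]_N + [k−j]_N = N−1; (ii) [j−i−1]_N + [l−k]_N < N and [i−l]_N + [k−j]_N < N; (iii) (l ≤ i and i < j and j ≤ k), or (i < j and j ≤ k and k ≤ l), or (j ≤ k and k ≤ l and l ≤ i), or (k ≤ l and l ≤ i and i < j). -/
open Finset

theorem stmt13 (m N : ℕ) (hm : 1 ≤ m) (hN : N = 2 * m + 1)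
    (i j k l : ℕ) (hi : i < N) (hj : j < N) (hk : k < N) (hl : l < N) :
    (resN N ((j : ℤ) - i - 1) + resN N ((l : ℤ) - k) + resN N ((i : ℤ) - l) + resN N ((k : ℤ) - j)
        = N - 1
      ↔ (resN N ((j : ℤ) - i - 1) + resN N ((l : ℤ) - k) < N ∧
          resN N ((i : ℤ) - l) + resN N ((k : ℤ) - j) < N)) ∧
    ((resN N ((j : ℤ) - i - 1) + resN N ((l : ℤ) - k) < N ∧
        resN N ((i : ℤ) - l) + resN N ((k : ℤ) - j) < N)
      ↔ ((l ≤ i ∧ i < j ∧ j ≤ k) ∨ (i < j ∧ j ≤ k ∧ k ≤ l) ∨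
          (j ≤ k ∧ k ≤ l ∧ l ≤ i) ∨ (k ≤ l ∧ l ≤ i ∧ i < j))) := by
  have key : ∀ x : ℤ, -(N : ℤ) ≤ x → x < N →
      (0 ≤ x ∧ (resN N x : ℤ) = x) ∨ (x < 0 ∧ (resN N x : ℤ) = x + N) := by
    intro x h1 h2
    unfold resN
    rcases lt_or_ge x 0 with h | h
    · right
      refine ⟨h, ?_⟩
      have e : x % (N : ℤ) = x + N := by
        rw [← Int.add_emod_right, Int.emod_eq_of_lt (by omega) (by omega)]
      rw [e]; omega
    · left
      refine ⟨h, ?_⟩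
      rw [Int.emod_eq_of_lt h h2]; omega
  have a := key ((j : ℤ) - i - 1) (by omega) (by omega)
  have b := key ((l : ℤ) - k) (by omega) (by omega)
  have c := key ((i : ℤ) - l) (by omega) (by omega)
  have d := key ((k : ℤ) - j) (by omega) (by omega)
  clear key
  generalize resN N ((j : ℤ) - i - 1) = A at *
  generalize resN N ((l : ℤ) - k) = B at *
  generalize resN N ((i : ℤ) - l) = C at *
  generalize resN N ((k : ℤ) - j) = D at *
  clear hm hN m
  rcases a with ⟨a, a'⟩ | ⟨a, a'⟩ <;> rcases b with ⟨b, b'⟩ | ⟨b, b'⟩ <;>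
    rcases c with ⟨c, c'⟩ | ⟨c, c'⟩ <;> rcases d with ⟨d, d'⟩ | ⟨d, d'⟩ <;>
    refine ⟨⟨fun h => ?_, fun h => ?_⟩, ⟨fun h => ?_, fun h => ?_⟩⟩ <;> omega
end
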